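/- arXiv:1303.4005 — 2 statements merged into one kernel-verified Lean document; each statement's English description precedes it below -/
import Mathlib

section
/- Let X, X₁, …, Xₙ be i.i.d. real-valued random variables with M(1) > 0, and let a = (a₁, …, aₙ) with aₖ ∈ ℝ^d be such that the matrix 𝑁 = Σₖ aₖaₖᵀ is positive definite. Suppose that for some α > 0 one has Σₖ(⟨t,aₖ⟩ − mₖ)² ≥ α² for all integers m₁, …, mₙ and all t ∈ ℝ^d with ‖t‖ ≤ √d and maxₖ|⟨t,aₖ⟩| ≥ 1/2. Then there exist absolute constants c₁, c₂ > 0 (independent of d, n, a, and the law of X) such that Q(F_a, √d) ≤ c₁^d ( (M(1))^{-d/2} (det 𝑁)^{-1/2} + exp(−c₂ α² M(1)) ). -/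
open MeasureTheory
open scoped RealInnerProductSpace

/-- Concentration function `Q(μ, r) = sup_x μ(x + rB)` of a measure on `ℝ^d`. -/
noncomputable def concFn {d : ℕ} (μ : Measure (EuclideanSpace ℝ (Fin d))) (r : ℝ) : ℝ :=
  ⨆ x : EuclideanSpace ℝ (Fin d), (μ (Metric.closedBall x r)).toReal

/-- Law of `S_a = ∑ k, X_k • a_k`, where `X_1, …, X_n` are i.i.d. with law `ν`. -/
noncomputable def sumLaw {d n : ℕ} (ν : Measure ℝ) (a : Fin n → EuclideanSpace ℝ (Fin d)) :
    Measure (EuclideanSpace ℝ (Fin d)) :=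
  (Measure.pi fun _ : Fin n => ν).map (fun ω => ∑ k, ω k • a k)

/-- `M(τ) = E min(X̃²/τ², 1)`, where `X̃ = X₁ - X₂` with `X₁, X₂` i.i.d. of law `ν`. -/
noncomputable def Mfn (ν : Measure ℝ) (τ : ℝ) : ℝ :=
  ∫ p : ℝ × ℝ, min ((p.1 - p.2) ^ 2 / τ ^ 2) 1 ∂(ν.prod ν)

/-- The matrix `𝑁 = ∑ k, aₖ aₖᵀ`. -/
noncomputable def covMat {d n : ℕ} (a : Fin n → EuclideanSpace ℝ (Fin d)) :
    Matrix (Fin d) (Fin d) ℝ :=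
  Matrix.of fun i j => ∑ k, a k i * a k j

lemma sum_inner_sq_eq {d n : ℕ} (a : Fin n → EuclideanSpace ℝ (Fin d))
    (t : EuclideanSpace ℝ (Fin d)) :
    ∑ k, ⟪t, a k⟫ ^ 2 = ⟪t, (covMat a).toEuclideanLin t⟫ := by
  simp only [PiLp.inner_apply, RCLike.inner_apply, conj_trivial, Matrix.toLpLin_apply,
    Matrix.mulVec, dotProduct, covMat, Matrix.of_apply, sq, Finset.sum_mul_sum]
  simp only [Finset.sum_mul]
  rw [Finset.sum_comm]
  refine Finset.sum_congr rfl fun i _ => ?_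
  rw [Finset.sum_comm]
  refine Finset.sum_congr rfl fun j _ => Finset.sum_congr rfl fun k _ => ?_
  ring

open scoped MatrixOrder in
/-- A linear map whose squared norm is the quadratic form `t ↦ ∑ ⟪t, aₖ⟫²`. -/
lemma exists_linearMap_norm_sq_eq {d n : ℕ} (a : Fin n → EuclideanSpace ℝ (Fin d))
    (hN : (covMat a).PosDef) :
    ∃ T : EuclideanSpace ℝ (Fin d) →ₗ[ℝ] EuclideanSpace ℝ (Fin d),
      LinearMap.det T = Real.sqrt (covMat a).det ∧ ∀ t, ‖T t‖ ^ 2 = ∑ k, ⟪t, a k⟫ ^ 2 := by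
  have hps := hN.posSemidef
  have h0 : 0 ≤ covMat a := Matrix.nonneg_iff_posSemidef.2 hps
  set B := CFC.sqrt (covMat a) with hB
  have hBB : B * B = covMat a := CFC.sqrt_mul_sqrt_self _ h0
  have hBs : B.IsHermitian := (Matrix.nonneg_iff_posSemidef.1 (CFC.sqrt_nonneg (covMat a))).1
  refine ⟨B.toEuclideanLin, ?_, fun t => ?_⟩
  · rw [Matrix.toEuclideanLin_eq_toLin_orthonormal, LinearMap.det_toLin]
    rw [hB, hps.det_sqrt]
    simp
  · rw [sum_inner_sq_eq, ← hBB, ← real_inner_self_eq_norm_sq]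
    have hadj : B.toEuclideanLin = LinearMap.adjoint B.toEuclideanLin := by
      conv_lhs => rw [← hBs.eq, Matrix.toEuclideanLin_conjTranspose_eq_adjoint]
    have hmul : (B * B).toEuclideanLin t = B.toEuclideanLin (B.toEuclideanLin t) := by
      simp [Matrix.toLpLin_apply]
    rw [hmul]
    conv_rhs => rw [hadj, LinearMap.adjoint_inner_right, ← hadj]

lemma integrable_exp_neg_mul_norm_sq {d : ℕ} {b : ℝ} (hb : 0 < b) :
    Integrable fun t : EuclideanSpace ℝ (Fin d) => Real.exp (-b * ‖t‖ ^ 2) := by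
  have h := (GaussianFourier.integrable_cexp_neg_mul_sq_norm_add (b := (b : ℂ)) (by simpa) 0
    (0 : EuclideanSpace ℝ (Fin d))).norm
  refine h.congr (Filter.Eventually.of_forall fun t => ?_)
  simp only [Complex.norm_exp]
  norm_cast
  simp

lemma integral_exp_neg_mul_norm_sq {d : ℕ} {b : ℝ} (hb : 0 < b) :
    ∫ t : EuclideanSpace ℝ (Fin d), Real.exp (-b * ‖t‖ ^ 2) = Real.sqrt (Real.pi / b) ^ d := by
  rw [GaussianFourier.integral_rexp_neg_mul_sq_norm hb, finrank_euclideanSpace_fin,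
    Real.rpow_div_two_eq_sqrt _ (by positivity), Real.rpow_natCast]

lemma integrable_and_integral_exp_neg_quadratic {d n : ℕ} (a : Fin n → EuclideanSpace ℝ (Fin d))
    (hN : (covMat a).PosDef) {b : ℝ} (hb : 0 < b) :
    Integrable (fun t => Real.exp (-b * ∑ k, ⟪t, a k⟫ ^ 2)) ∧
      ∫ t, Real.exp (-b * ∑ k, ⟪t, a k⟫ ^ 2) =
        Real.sqrt (Real.pi / b) ^ d * (1 / Real.sqrt (covMat a).det) := by
  obtain ⟨T, hdet, hT⟩ := exists_linearMap_norm_sq_eq a hN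
  have hpos : 0 < Real.sqrt (covMat a).det := Real.sqrt_pos.2 hN.det_pos
  have hmap := Measure.map_linearMap_addHaar_eq_smul_addHaar
    (volume : Measure (EuclideanSpace ℝ (Fin d))) (f := T) (by rw [hdet]; exact hpos.ne')
  have hTc : Continuous T := T.continuous_of_finiteDimensional
  have hinteg : Integrable (fun t => Real.exp (-b * ‖t‖ ^ 2))
      (Measure.map T (volume : Measure (EuclideanSpace ℝ (Fin d)))) := by
    rw [hmap]
    exact (integrable_exp_neg_mul_norm_sq hb).smul_measure ENNReal.ofReal_ne_top
  simp only [← hT]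
  refine ⟨hinteg.comp_measurable hTc.measurable, ?_⟩
  rw [← integral_map (φ := T) (f := fun t => Real.exp (-b * ‖t‖ ^ 2))
    hTc.measurable.aemeasurable hinteg.1, hmap, integral_smul_measure,
    integral_exp_neg_mul_norm_sq hb, ENNReal.toReal_ofReal (abs_nonneg _), hdet,
    abs_of_pos (inv_pos.2 hpos), smul_eq_mul]
  ring

/-- `G` is the characteristic function of a probability measure. -/
def IsProbCharFun {d : ℕ} (G : EuclideanSpace ℝ (Fin d) → ℂ) : Prop :=
  ∃ μ : Measure (EuclideanSpace ℝ (Fin d)), IsProbabilityMeasure μ ∧ charFun μ = G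

lemma IsProbCharFun.mul {d : ℕ} {F G : EuclideanSpace ℝ (Fin d) → ℂ}
    (hF : IsProbCharFun F) (hG : IsProbCharFun G) : IsProbCharFun fun t => F t * G t := by
  obtain ⟨μ, hμ, rfl⟩ := hF
  obtain ⟨ν, hν, rfl⟩ := hG
  exact ⟨μ.conv ν, inferInstance, funext fun t => charFun_conv t⟩

lemma isProbCharFun_one {d : ℕ} : IsProbCharFun fun _ : EuclideanSpace ℝ (Fin d) => (1 : ℂ) :=
  ⟨Measure.dirac 0, inferInstance, funext fun t => by simp [charFun_dirac]⟩

lemma IsProbCharFun.prod {d : ℕ} {ι : Type*} (s : Finset ι) {F : ι → EuclideanSpace ℝ (Fin d) → ℂ}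
    (hF : ∀ i ∈ s, IsProbCharFun (F i)) : IsProbCharFun fun t => ∏ i ∈ s, F i t := by
  classical
  induction s using Finset.induction_on with
  | empty => simpa using isProbCharFun_one
  | insert i s hi ih =>
    simp only [Finset.prod_insert hi]
    exact (hF i (by simp)).mul (ih fun j hj => hF j (by simp [hj]))

open ProbabilityTheory in
lemma isProbCharFun_poisson {d : ℕ} (r : NNReal) (b : EuclideanSpace ℝ (Fin d)) :
    IsProbCharFun fun t => Complex.exp (r * (Complex.exp (⟪b, t⟫ * Complex.I) - 1)) := by
  refine ⟨((poissonMeasure r).map (Nat.cast : ℕ → ℝ)).map (fun x => x • b), ?_, funext fun t => ?_⟩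
  · have : IsProbabilityMeasure ((poissonMeasure r).map (Nat.cast : ℕ → ℝ)) :=
      Measure.isProbabilityMeasure_map (by fun_prop)
    exact Measure.isProbabilityMeasure_map (by fun_prop)
  · rw [← charFun_map_cast_poissonMeasure, charFun_apply, charFun_apply,
      integral_map (by fun_prop) (by fun_prop)]
    simp [inner_smul_left, mul_comm]

/-- The symmetrized compound Poisson law has characteristic function
`exp (-c * ∑ (1 - cos ⟪t, bₖ⟫))`. -/
lemma isProbCharFun_exp_cos {d n : ℕ} (b : Fin n → EuclideanSpace ℝ (Fin d)) {c : ℝ} (hc : 0 ≤ c) :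
    IsProbCharFun fun t => ((Real.exp (-c * ∑ k, (1 - Real.cos ⟪t, b k⟫)) : ℝ) : ℂ) := by
  obtain ⟨r, hr⟩ : ∃ r : NNReal, (r : ℝ) = c / 2 := ⟨⟨c / 2, by positivity⟩, rfl⟩
  have hr' : ((r : ℝ) : ℂ) = c / 2 := by rw [hr]; push_cast; ring
  have h := IsProbCharFun.prod Finset.univ fun k (_ : k ∈ Finset.univ) =>
    (isProbCharFun_poisson r (b k)).mul (isProbCharFun_poisson r (-b k))
  convert h using 2 with t
  simp only [← Complex.exp_add]
  rw [← Complex.exp_sum]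
  push_cast
  congr 1
  rw [Finset.mul_sum]
  refine Finset.sum_congr rfl fun k _ => ?_
  rw [real_inner_comm (b k) t, Complex.cos,
    inner_neg_left, hr']
  push_cast
  ring_nf

/-- Averages of a positive definite function over translates of `A - A` are maximal at the
origin. -/
lemma integral_prod_charFun_add_le {d : ℕ} {G : EuclideanSpace ℝ (Fin d) → ℝ}
    (hG : IsProbCharFun fun t => (G t : ℂ)) (P : Measure (EuclideanSpace ℝ (Fin d)))
    [IsFiniteMeasure P] (s : EuclideanSpace ℝ (Fin d)) :
    ∫ p, G (s + p.1 - p.2) ∂(P.prod P) ≤ ∫ p, G (p.1 - p.2) ∂(P.prod P) := by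
  obtain ⟨μ, hμ, hμG⟩ := hG
  set Φ : EuclideanSpace ℝ (Fin d) → ℂ := fun y => ∫ u, Complex.exp (⟪y, u⟫ * Complex.I) ∂P
  have key : ∀ s, ((∫ p, G (s + p.1 - p.2) ∂(P.prod P) : ℝ) : ℂ) =
      ∫ y, Complex.exp (⟪y, s⟫ * Complex.I) * ((‖Φ y‖ ^ 2 : ℝ) : ℂ) ∂μ := by
    intro s
    rw [← integral_complex_ofReal]
    have h1 : ∀ p : EuclideanSpace ℝ (Fin d) × EuclideanSpace ℝ (Fin d),
        (G (s + p.1 - p.2) : ℂ) =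
          ∫ y, Complex.exp (⟪y, s + p.1 - p.2⟫ * Complex.I) ∂μ := fun p => by
      rw [← charFun_apply, hμG]
    simp only [h1]
    rw [integral_integral_swap]
    · refine integral_congr_ae (Filter.Eventually.of_forall fun y => ?_)
      simp only
      have h2 : ∀ p : EuclideanSpace ℝ (Fin d) × EuclideanSpace ℝ (Fin d),
          Complex.exp (⟪y, s + p.1 - p.2⟫ * Complex.I) = Complex.exp (⟪y, s⟫ * Complex.I) *
            (Complex.exp (⟪y, p.1⟫ * Complex.I) *
              (starRingEnd ℂ) (Complex.exp (⟪y, p.2⟫ * Complex.I))) := fun p => by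
        rw [← Complex.exp_conj, ← Complex.exp_add, ← Complex.exp_add, inner_sub_right,
          inner_add_right]
        congr 1
        simp
        ring
      simp only [h2]
      rw [integral_const_mul, integral_prod_mul (fun u => Complex.exp (⟪y, u⟫ * Complex.I))
        (fun u => (starRingEnd ℂ) (Complex.exp (⟪y, u⟫ * Complex.I))), integral_conj,
        Complex.mul_conj, Complex.normSq_eq_norm_sq]
    · refine Integrable.of_bound (C := 1) ?_ (Filter.Eventually.of_forall fun q => ?_)
      · exact Continuous.aestronglyMeasurable (by simp only [Function.uncurry_def]; fun_prop)
      · simp [Function.uncurry_def, Complex.norm_exp]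
  have h0 := key 0
  simp only [zero_add, inner_zero_right, Complex.ofReal_zero, zero_mul, Complex.exp_zero,
    one_mul] at h0
  rw [integral_complex_ofReal, Complex.ofReal_inj] at h0
  calc ∫ p, G (s + p.1 - p.2) ∂(P.prod P)
      ≤ ‖((∫ p, G (s + p.1 - p.2) ∂(P.prod P) : ℝ) : ℂ)‖ := by
        rw [Complex.norm_real]; exact le_abs_self _
    _ ≤ ∫ y, ‖Complex.exp (⟪y, s⟫ * Complex.I) * ((‖Φ y‖ ^ 2 : ℝ) : ℂ)‖ ∂μ := by
        rw [key s]; exact norm_integral_le_integral_norm _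
    _ = ∫ y, ‖Φ y‖ ^ 2 ∂μ := by
        congr 1; ext y; simp [Complex.norm_exp]
    _ = _ := h0.symm

/-- A Gaussian average of a nonnegative characteristic function is controlled by its average over
a small ball around the origin. -/
lemma measureReal_ball_mul_integral_gaussian_le {d : ℕ} {G : EuclideanSpace ℝ (Fin d) → ℝ}
    (hG : IsProbCharFun fun t => (G t : ℂ)) (hGc : Continuous G) (hG0 : ∀ t, 0 ≤ G t)
    (hG1 : ∀ t, G t ≤ 1) {R : ℝ} (hR : 0 < R) (hRd : 2 * R ≤ Real.sqrt d) :
    volume.real (Metric.closedBall (0 : EuclideanSpace ℝ (Fin d)) R) *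
        ∫ t, Real.exp (-(1 / 2) * ‖t‖ ^ 2) * G t ≤
      (Real.exp (d / 2) * Real.sqrt (4 * Real.pi) ^ d) *
        ∫ t in Metric.closedBall 0 (2 * R), G t := by
  set A := Metric.closedBall (0 : EuclideanSpace ℝ (Fin d)) R with hA
  have hAm : MeasurableSet A := Metric.isClosed_closedBall.measurableSet
  have hAfin : volume A ≠ ⊤ := measure_closedBall_lt_top.ne
  have : IsFiniteMeasure (volume.restrict A) := ⟨by simpa using measure_closedBall_lt_top⟩
  set P := volume.restrict A with hP
  set I := ∫ t, Real.exp (-(1 / 2) * ‖t‖ ^ 2) * G t with hI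
  set V := volume.real A with hV
  have hVpos : 0 < V := ENNReal.toReal_pos (Metric.measure_closedBall_pos _ _ hR).ne' hAfin
  have hPu : P.real Set.univ = V := by simp [hP, hV, Measure.real]
  have hgi : ∀ w, ∀ b : ℝ, 0 < b → Integrable fun t => Real.exp (-b * ‖t‖ ^ 2) * G (t + w) := by
    intro w b hb
    refine (integrable_exp_neg_mul_norm_sq hb).mono' (Continuous.aestronglyMeasurable (by fun_prop))
      (Filter.Eventually.of_forall fun t => ?_)
    rw [Real.norm_of_nonneg (mul_nonneg (Real.exp_pos _).le (hG0 _))]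
    exact mul_le_of_le_one_right (Real.exp_pos _).le (hG1 _)
  have hshift : ∀ p ∈ A ×ˢ A,
      I ≤ Real.exp (d / 2) * ∫ s, Real.exp (-(1 / 4) * ‖s‖ ^ 2) * G (s + (p.1 - p.2)) := by
    rintro ⟨u, v⟩ ⟨hu, hv⟩
    simp only [hA, mem_closedBall_zero_iff] at hu hv
    rw [hI, ← integral_add_right_eq_self _ (u - v), ← integral_const_mul]
    refine integral_mono ?_ ((hgi _ _ (by norm_num)).const_mul _) fun s => ?_
    · have := (hgi 0 (1 / 2) (by norm_num)).comp_add_right (u - v)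
      simpa using this
    · simp only
      rw [← mul_assoc, ← Real.exp_add]
      refine mul_le_mul_of_nonneg_right (Real.exp_le_exp.2 ?_) (hG0 _)
      have h1 : ‖u - v‖ ≤ Real.sqrt d := (norm_sub_le _ _).trans (by linarith)
      have h2 : ‖u - v‖ ^ 2 ≤ d := by
        calc _ ≤ Real.sqrt d ^ 2 := by gcongr
          _ = d := Real.sq_sqrt (by positivity)
      have h3 : ‖s‖ ≤ ‖s + (u - v)‖ + ‖u - v‖ := by
        simpa using norm_sub_le (s + (u - v)) (u - v)
      have h4 : ‖s‖ ^ 2 ≤ (‖s + (u - v)‖ + ‖u - v‖) ^ 2 := by gcongr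
      nlinarith [sq_nonneg (‖s + (u - v)‖ - ‖u - v‖)]
  have hprodint : Integrable (fun q : (EuclideanSpace ℝ (Fin d) × EuclideanSpace ℝ (Fin d)) ×
      EuclideanSpace ℝ (Fin d) => Real.exp (-(1 / 4) * ‖q.2‖ ^ 2) * G (q.2 + (q.1.1 - q.1.2)))
      ((P.prod P).prod volume) := by
    have h := (integrable_const (1 : ℝ) (μ := P.prod P)).mul_prod
      (integrable_exp_neg_mul_norm_sq (d := d) (b := 1 / 4) (by norm_num))
    refine h.mono' (Continuous.aestronglyMeasurable (by fun_prop))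
      (Filter.Eventually.of_forall fun q => ?_)
    rw [Real.norm_of_nonneg (mul_nonneg (Real.exp_pos _).le (hG0 _)), one_mul]
    exact mul_le_of_le_one_right (Real.exp_pos _).le (hG1 _)
  set K := ∫ p, G (p.1 - p.2) ∂(P.prod P) with hK
  have hK0 : 0 ≤ K := integral_nonneg fun p => hG0 _
  have hstep : V ^ 2 * I ≤ Real.exp (d / 2) * (Real.sqrt (4 * Real.pi) ^ d * K) := by
    calc V ^ 2 * I = ∫ _, I ∂(P.prod P) := by
          rw [integral_const, ← hPu, smul_eq_mul, ← Set.univ_prod_univ, measureReal_prod_prod, sq]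
      _ ≤ ∫ p, Real.exp (d / 2) *
            (∫ s, Real.exp (-(1 / 4) * ‖s‖ ^ 2) * G (s + (p.1 - p.2))) ∂(P.prod P) := by
          refine integral_mono_ae (integrable_const _) (hprodint.integral_prod_left.const_mul _) ?_
          rw [hP, Measure.prod_restrict]
          filter_upwards [ae_restrict_mem (hAm.prod hAm)] with p hp using hshift p hp
      _ = Real.exp (d / 2) * ∫ s, ∫ p, Real.exp (-(1 / 4) * ‖s‖ ^ 2) *
            G (s + (p.1 - p.2)) ∂(P.prod P) := by
          rw [integral_const_mul, integral_integral_swap hprodint]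
      _ ≤ Real.exp (d / 2) * ∫ s : EuclideanSpace ℝ (Fin d),
            Real.exp (-(1 / 4) * ‖s‖ ^ 2) * K := by
          refine mul_le_mul_of_nonneg_left ?_ (Real.exp_pos _).le
          refine integral_mono hprodint.integral_prod_right
            ((integrable_exp_neg_mul_norm_sq (by norm_num)).mul_const _) fun s => ?_
          simp only [integral_const_mul]
          refine mul_le_mul_of_nonneg_left ?_ (Real.exp_pos _).le
          simpa only [add_sub_assoc] using integral_prod_charFun_add_le hG P s
      _ = _ := by
          rw [integral_mul_const, integral_exp_neg_mul_norm_sq (by norm_num)]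
          congr 4
          ring
  have hGloc : ∀ r, IntegrableOn G (Metric.closedBall 0 r) := fun r =>
    hGc.continuousOn.integrableOn_compact (isCompact_closedBall _ _)
  have hKle : K ≤ V * ∫ t in Metric.closedBall 0 (2 * R), G t := by
    have hKint : Integrable (fun p : EuclideanSpace ℝ (Fin d) × EuclideanSpace ℝ (Fin d) =>
        G (p.1 - p.2)) (P.prod P) := by
      refine (integrable_const (1 : ℝ)).mono' (Continuous.aestronglyMeasurable (by fun_prop))
        (Filter.Eventually.of_forall fun p => ?_)
      rw [Real.norm_of_nonneg (hG0 _)]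
      exact hG1 _
    rw [hK, integral_prod_symm _ hKint]
    have : V * ∫ t in Metric.closedBall 0 (2 * R), G t =
        ∫ _, (∫ t in Metric.closedBall 0 (2 * R), G t) ∂P := by
      rw [integral_const, hPu, smul_eq_mul]
    rw [this]
    refine integral_mono_ae hKint.integral_prod_right (integrable_const _) ?_
    rw [hP]
    filter_upwards [ae_restrict_mem hAm] with v hv
    simp only [hA, mem_closedBall_zero_iff] at hv
    rw [← integral_indicator hAm, ← integral_indicator Metric.isClosed_closedBall.measurableSet]
    have hi : Integrable ((Metric.closedBall 0 (2 * R)).indicator G) :=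
      (hGloc _).integrable_indicator Metric.isClosed_closedBall.measurableSet
    refine (integral_mono_of_nonneg (Filter.Eventually.of_forall fun u =>
      Set.indicator_nonneg (fun _ _ => hG0 _) _) (hi.comp_sub_right v)
      (Filter.Eventually.of_forall fun u => ?_)).trans_eq (integral_sub_right_eq_self _ v)
    by_cases hu : u ∈ A
    · have hu' : u - v ∈ Metric.closedBall (0 : EuclideanSpace ℝ (Fin d)) (2 * R) := by
        simp only [hA, mem_closedBall_zero_iff] at hu ⊢
        exact (norm_sub_le _ _).trans (by linarith)
      simp [hu, hu']
    · simp only [hu, not_false_eq_true, Set.indicator_of_notMem]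
      exact Set.indicator_nonneg (fun _ _ => hG0 _) _
  refine le_of_mul_le_mul_left ?_ hVpos
  calc V * (V * I) = V ^ 2 * I := by ring
    _ ≤ Real.exp (d / 2) * (Real.sqrt (4 * Real.pi) ^ d * K) := hstep
    _ ≤ Real.exp (d / 2) * (Real.sqrt (4 * Real.pi) ^ d *
          (V * ∫ t in Metric.closedBall 0 (2 * R), G t)) := by gcongr
    _ = _ := by ring

lemma eight_mul_sq_sub_round_le (u : ℝ) :
    8 * (u - round u) ^ 2 ≤ 1 - Real.cos (2 * Real.pi * u) := by
  have h1 : Real.cos (2 * Real.pi * u) = Real.cos (2 * Real.pi * (u - round u)) := by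
    rw [← Real.cos_sub_int_mul_two_pi (2 * Real.pi * u) (round u)]
    congr 1
    ring
  have h2 : |2 * Real.pi * (u - round u)| ≤ Real.pi := by
    rw [abs_mul, abs_of_pos (by positivity)]
    nlinarith [abs_sub_round u, Real.pi_pos]
  have h3 := Real.cos_le_one_sub_mul_cos_sq h2
  rw [h1]
  have h4 : 2 / Real.pi ^ 2 * (2 * Real.pi * (u - round u)) ^ 2 = 8 * (u - round u) ^ 2 := by
    field_simp
    ring
  linarith

lemma pow_le_measureReal_closedBall {d : ℕ} {h : ℝ} (hh : 0 ≤ h) :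
    (2 * h) ^ d ≤ volume.real (Metric.closedBall (0 : EuclideanSpace ℝ (Fin d))
      (Real.sqrt d * h)) := by
  have hbox : volume.real (WithLp.ofLp ⁻¹' (Set.univ.pi fun _ : Fin d => Set.Icc (-h) h) :
      Set (EuclideanSpace ℝ (Fin d))) = (2 * h) ^ d := by
    rw [measureReal_def, (PiLp.volume_preserving_ofLp (Fin d)).measure_preimage
      (MeasurableSet.univ_pi fun _ => measurableSet_Icc).nullMeasurableSet, volume_pi_pi]
    simp [two_mul, hh]
  rw [← hbox]
  refine measureReal_mono (fun x hx => ?_) measure_closedBall_lt_top.ne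
  simp only [Set.mem_preimage, Set.mem_univ_pi, Set.mem_Icc] at hx
  rw [mem_closedBall_zero_iff, EuclideanSpace.norm_eq]
  refine Real.sqrt_le_iff.2 ⟨by positivity, ?_⟩
  calc ∑ i, ‖x i‖ ^ 2 ≤ ∑ _i : Fin d, h ^ 2 := by
        refine Finset.sum_le_sum fun i _ => ?_
        rw [Real.norm_eq_abs, sq_abs]
        exact sq_le_sq' (hx i).1 (hx i).2
    _ = (Real.sqrt d * h) ^ 2 := by
        rw [mul_pow, Real.sq_sqrt (by positivity)]
        simp

/-- On the ball where `(z / 2π) t` satisfies the arithmetic hypothesis, the compound Poisson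
characteristic function is either dominated by a Gaussian or exponentially small. -/
lemma exp_cos_le_of_dist {d n : ℕ} (a : Fin n → EuclideanSpace ℝ (Fin d)) {M α z : ℝ}
    (hM : 0 < M) (hz : z ≠ 0)
    (h : ∀ (m : Fin n → ℤ) (t : EuclideanSpace ℝ (Fin d)),
      ‖t‖ ≤ Real.sqrt d → (∃ k, (1 / 2 : ℝ) ≤ |⟪t, a k⟫|) → α ^ 2 ≤ ∑ k, (⟪t, a k⟫ - m k) ^ 2)
    (t : EuclideanSpace ℝ (Fin d)) (ht : |z| / (2 * Real.pi) * ‖t‖ ≤ Real.sqrt d) :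
    Real.exp (-(M / (2 * min (z ^ 2) 1)) * ∑ k, (1 - Real.cos ⟪t, z • a k⟫)) ≤
      Real.exp (-(M * z ^ 2 / (Real.pi ^ 2 * min (z ^ 2) 1)) * ∑ k, ⟪t, a k⟫ ^ 2) +
        Real.exp (-4 * α ^ 2 * M) := by
  have hπ := Real.pi_pos
  have hm : 0 < min (z ^ 2) 1 := lt_min (by positivity) one_pos
  have hm1 : min (z ^ 2) 1 ≤ 1 := min_le_right _ _
  set m := min (z ^ 2) 1
  set u : EuclideanSpace ℝ (Fin d) := (z / (2 * Real.pi)) • t with hu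
  have hun : ‖u‖ ≤ Real.sqrt d := by
    rwa [hu, norm_smul, Real.norm_eq_abs, abs_div, abs_of_pos (by positivity : 0 < 2 * Real.pi)]
  have huk : ∀ k, ⟪t, z • a k⟫ = 2 * Real.pi * ⟪u, a k⟫ := fun k => by
    rw [hu, inner_smul_left, inner_smul_right]
    simp only [conj_trivial]
    field_simp
  by_cases hk : ∃ k, (1 / 2 : ℝ) ≤ |⟪u, a k⟫|
  · refine le_add_of_nonneg_of_le (Real.exp_pos _).le (Real.exp_le_exp.2 ?_)
    have h1 := h (fun k => round ⟪u, a k⟫) u hun hk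
    have h2 : 8 * α ^ 2 ≤ ∑ k, (1 - Real.cos ⟪t, z • a k⟫) := by
      calc 8 * α ^ 2 ≤ 8 * ∑ k, (⟪u, a k⟫ - round ⟪u, a k⟫) ^ 2 := by linarith
        _ ≤ _ := by
          rw [Finset.mul_sum]
          refine Finset.sum_le_sum fun k _ => ?_
          rw [huk]
          exact eight_mul_sq_sub_round_le _
    have h3 : M / 2 ≤ M / (2 * m) := by gcongr; linarith
    have h4 : M / 2 * (8 * α ^ 2) ≤ M / (2 * m) * ∑ k, (1 - Real.cos ⟪t, z • a k⟫) := by gcongr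
    linarith
  · refine le_add_of_le_of_nonneg (Real.exp_le_exp.2 ?_) (Real.exp_pos _).le
    push Not at hk
    have h2 : 2 / Real.pi ^ 2 * z ^ 2 * ∑ k, ⟪t, a k⟫ ^ 2 ≤
        ∑ k, (1 - Real.cos ⟪t, z • a k⟫) := by
      rw [Finset.mul_sum]
      refine Finset.sum_le_sum fun k _ => ?_
      have h3 : |⟪t, z • a k⟫| ≤ Real.pi := by
        rw [huk, abs_mul, abs_of_pos (by positivity)]
        nlinarith [hk k]
      have h4 := Real.cos_le_one_sub_mul_cos_sq h3
      have h5 : ⟪t, z • a k⟫ = z * ⟪t, a k⟫ := inner_smul_right _ _ _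
      have h6 : 2 / Real.pi ^ 2 * ⟪t, z • a k⟫ ^ 2 =
          2 / Real.pi ^ 2 * z ^ 2 * ⟪t, a k⟫ ^ 2 := by rw [h5]; ring
      linarith
    have h3 : M * z ^ 2 / (Real.pi ^ 2 * m) * ∑ k, ⟪t, a k⟫ ^ 2 =
        M / (2 * m) * (2 / Real.pi ^ 2 * z ^ 2 * ∑ k, ⟪t, a k⟫ ^ 2) := by
      field_simp
    have h4 : M / (2 * m) * (2 / Real.pi ^ 2 * z ^ 2 * ∑ k, ⟪t, a k⟫ ^ 2) ≤
        M / (2 * m) * ∑ k, (1 - Real.cos ⟪t, z • a k⟫) := by gcongr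
    linarith

/-- Esseen's inequality with Gaussian smoothing. -/
lemma concFn_sqrt_le_integral_norm_charFun {d : ℕ} (μ : Measure (EuclideanSpace ℝ (Fin d)))
    [IsProbabilityMeasure μ] :
    concFn μ (Real.sqrt d) ≤ Real.exp (d / 2) * (1 / Real.sqrt (2 * Real.pi)) ^ d *
      ∫ t, Real.exp (-(1 / 2) * ‖t‖ ^ 2) * ‖charFun μ t‖ := by
  refine ciSup_le fun x => ?_
  have hgauss : ∀ w : EuclideanSpace ℝ (Fin d),
      ((Real.sqrt (2 * Real.pi) ^ d * Real.exp (-(1 / 2) * ‖w‖ ^ 2) : ℝ) : ℂ) =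
        ∫ t : EuclideanSpace ℝ (Fin d),
          Complex.exp (-(1 / 2 : ℂ) * ‖t‖ ^ 2 + Complex.I * ⟪w, t⟫) := by
    intro w
    rw [GaussianFourier.integral_cexp_neg_mul_sq_norm_add (by norm_num), finrank_euclideanSpace_fin]
    have h1 : ((Real.pi : ℂ) / (1 / 2)) ^ ((d : ℂ) / 2) = ((Real.sqrt (2 * Real.pi) ^ d : ℝ) : ℂ) := by
      rw [← Real.rpow_natCast, ← Real.rpow_div_two_eq_sqrt _ (by positivity),
        Complex.ofReal_cpow (by positivity)]
      push_cast
      congr 1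
      ring
    rw [h1, Complex.ofReal_mul, Complex.I_sq]
    push_cast
    congr 2
    ring
  have hI : Integrable (fun q : EuclideanSpace ℝ (Fin d) × EuclideanSpace ℝ (Fin d) =>
      Complex.exp (-(1 / 2 : ℂ) * ‖q.2‖ ^ 2 + Complex.I * ⟪q.1 - x, q.2⟫)) (μ.prod volume) := by
    have h := (integrable_const (1 : ℝ) (μ := μ)).mul_prod
      (integrable_exp_neg_mul_norm_sq (d := d) (b := 1 / 2) (by norm_num))
    refine h.mono' (Continuous.aestronglyMeasurable (by fun_prop))
      (Filter.Eventually.of_forall fun q => ?_)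
    rw [Complex.norm_exp, one_mul]
    refine Real.exp_le_exp.2 (le_of_eq ?_)
    simp [← Complex.ofReal_pow]
  have hswap : ((Real.sqrt (2 * Real.pi) ^ d *
      ∫ y, Real.exp (-(1 / 2) * ‖y - x‖ ^ 2) ∂μ : ℝ) : ℂ) =
      ∫ t, Complex.exp (-(1 / 2 : ℂ) * ‖t‖ ^ 2 - Complex.I * ⟪x, t⟫) * charFun μ t := by
    rw [← integral_const_mul, ← integral_complex_ofReal]
    simp only [hgauss]
    rw [integral_integral_swap hI]
    refine integral_congr_ae (Filter.Eventually.of_forall fun t => ?_)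
    simp only
    rw [charFun_apply, ← integral_const_mul]
    refine integral_congr_ae (Filter.Eventually.of_forall fun y => ?_)
    simp only
    rw [← Complex.exp_add, inner_sub_left]
    congr 1
    push_cast
    ring
  have hnorm : Real.sqrt (2 * Real.pi) ^ d * ∫ y, Real.exp (-(1 / 2) * ‖y - x‖ ^ 2) ∂μ ≤
      ∫ t, Real.exp (-(1 / 2) * ‖t‖ ^ 2) * ‖charFun μ t‖ := by
    calc _ ≤ ‖((Real.sqrt (2 * Real.pi) ^ d *
          ∫ y, Real.exp (-(1 / 2) * ‖y - x‖ ^ 2) ∂μ : ℝ) : ℂ)‖ := by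
          rw [Complex.norm_real]; exact le_abs_self _
      _ ≤ ∫ t, ‖Complex.exp (-(1 / 2 : ℂ) * ‖t‖ ^ 2 - Complex.I * ⟪x, t⟫) * charFun μ t‖ := by
          rw [hswap]; exact norm_integral_le_integral_norm _
      _ = _ := by
          refine integral_congr_ae (Filter.Eventually.of_forall fun t => ?_)
          simp only
          rw [norm_mul, Complex.norm_exp]
          congr 2
          simp [← Complex.ofReal_pow]
  have hmark : (μ (Metric.closedBall x (Real.sqrt d))).toReal ≤
      Real.exp (d / 2) * ∫ y, Real.exp (-(1 / 2) * ‖y - x‖ ^ 2) ∂μ := by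
    rw [← measureReal_def, ← integral_indicator_one Metric.isClosed_closedBall.measurableSet,
      ← integral_const_mul]
    refine integral_mono ((integrable_const 1).indicator Metric.isClosed_closedBall.measurableSet)
      (Integrable.const_mul ?_ _) fun y => ?_
    · refine Integrable.of_bound (C := 1) (Continuous.aestronglyMeasurable (by fun_prop))
        (Filter.Eventually.of_forall fun y => ?_)
      rw [Real.norm_of_nonneg (Real.exp_pos _).le, Real.exp_le_one_iff]
      nlinarith [sq_nonneg ‖y - x‖]
    · refine Set.indicator_le' (f := 1) (s := Metric.closedBall x (Real.sqrt d))
        (g := fun y => Real.exp (d / 2) * Real.exp (-(1 / 2) * ‖y - x‖ ^ 2)) (fun y hy => ?_)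
        (fun y _ => by positivity) y
      rw [← Real.exp_add, Pi.one_apply, Real.one_le_exp_iff]
      rw [mem_closedBall_iff_norm] at hy
      have : ‖y - x‖ ^ 2 ≤ d := by
        calc _ ≤ Real.sqrt d ^ 2 := by gcongr
          _ = d := Real.sq_sqrt (by positivity)
      linarith
  have hpos : 0 < Real.sqrt (2 * Real.pi) ^ d := by positivity
  refine hmark.trans ?_
  rw [mul_assoc]
  refine mul_le_mul_of_nonneg_left ?_ (Real.exp_pos _).le
  rw [one_div_pow, one_div_mul_eq_div, le_div_iff₀ hpos, mul_comm]
  exact hnorm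

lemma sq_norm_charFun_eq {ν : Measure ℝ} [IsProbabilityMeasure ν] (s : ℝ) :
    ‖charFun ν s‖ ^ 2 = 1 - ∫ p : ℝ × ℝ, (1 - Real.cos ((p.1 - p.2) * s)) ∂(ν.prod ν) := by
  have hinteg : Integrable (fun p : ℝ × ℝ => Real.cos ((p.1 - p.2) * s)) (ν.prod ν) :=
    Integrable.of_bound (C := 1) (Continuous.aestronglyMeasurable (by fun_prop))
      (Filter.Eventually.of_forall fun p => Real.abs_cos_le_one _)
  have hintegc : Integrable (fun p : ℝ × ℝ => Complex.exp (((p.1 - p.2) * s : ℝ) * Complex.I))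
      (ν.prod ν) :=
    Integrable.of_bound (C := 1) (Continuous.aestronglyMeasurable (by fun_prop))
      (Filter.Eventually.of_forall fun p => by rw [Complex.norm_exp_ofReal_mul_I])
  rw [integral_sub (integrable_const 1) hinteg]
  simp only [integral_const, probReal_univ, smul_eq_mul, mul_one, sub_sub_cancel]
  have h1 : ((‖charFun ν s‖ ^ 2 : ℝ) : ℂ) =
      ∫ p : ℝ × ℝ, Complex.exp (((p.1 - p.2) * s : ℝ) * Complex.I) ∂(ν.prod ν) := by
    rw [← Complex.normSq_eq_norm_sq, ← Complex.mul_conj, charFun_apply, ← integral_conj,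
      ← integral_prod_mul]
    refine integral_congr_ae (Filter.Eventually.of_forall fun p => ?_)
    simp only [← Complex.exp_conj, ← Complex.exp_add]
    congr 1
    simp
    ring
  have h2 := congrArg Complex.re h1
  rw [Complex.ofReal_re] at h2
  rw [h2, ← RCLike.re_eq_complex_re, ← integral_re hintegc]
  simp only [RCLike.re_eq_complex_re, Complex.exp_ofReal_mul_I_re]

lemma norm_charFun_le_exp {ν : Measure ℝ} [IsProbabilityMeasure ν] (s : ℝ) :
    ‖charFun ν s‖ ≤
      Real.exp (-(1 / 2) * ∫ p : ℝ × ℝ, (1 - Real.cos ((p.1 - p.2) * s)) ∂(ν.prod ν)) := by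
  refine (pow_le_pow_iff_left₀ (norm_nonneg _) (Real.exp_pos _).le two_ne_zero).1 ?_
  rw [sq_norm_charFun_eq, ← Real.exp_nat_mul]
  refine (Real.one_sub_le_exp_neg _).trans (Real.exp_le_exp.2 (le_of_eq ?_))
  push_cast
  ring

lemma charFun_sumLaw {d n : ℕ} {ν : Measure ℝ} [IsProbabilityMeasure ν]
    (a : Fin n → EuclideanSpace ℝ (Fin d)) (t : EuclideanSpace ℝ (Fin d)) :
    charFun (sumLaw ν a) t = ∏ k, charFun ν ⟪t, a k⟫ := by
  rw [sumLaw, charFun_apply, integral_map (Continuous.aemeasurable (by fun_prop))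
    (Continuous.aestronglyMeasurable (by fun_prop))]
  simp only [charFun_apply]
  rw [← integral_fintype_prod_eq_prod]
  refine integral_congr_ae (Filter.Eventually.of_forall fun ω => ?_)
  simp only [← Complex.exp_sum, sum_inner, inner_smul_left]
  congr 1
  push_cast
  rw [Finset.sum_mul]
  refine Finset.sum_congr rfl fun k _ => ?_
  simp [real_inner_comm, mul_comm]

lemma norm_charFun_sumLaw_le_exp {d n : ℕ} {ν : Measure ℝ} [IsProbabilityMeasure ν]
    (a : Fin n → EuclideanSpace ℝ (Fin d)) (t : EuclideanSpace ℝ (Fin d)) :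
    ‖charFun (sumLaw ν a) t‖ ≤ Real.exp (-(1 / 2) *
      ∫ p : ℝ × ℝ, ∑ k, (1 - Real.cos ⟪t, (p.1 - p.2) • a k⟫) ∂(ν.prod ν)) := by
  rw [charFun_sumLaw, norm_prod, integral_finsetSum, Finset.mul_sum, Real.exp_sum]
  · refine Finset.prod_le_prod (fun _ _ => norm_nonneg _) fun k _ => ?_
    simpa only [inner_smul_right] using norm_charFun_le_exp (ν := ν) ⟪t, a k⟫
  · intro k _
    refine Integrable.of_bound (C := 2) (Continuous.aestronglyMeasurable (by fun_prop))
      (Filter.Eventually.of_forall fun p => ?_)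
    rw [Real.norm_eq_abs, abs_le]
    constructor <;> linarith [Real.neg_one_le_cos ⟪t, (p.1 - p.2) • a k⟫,
      Real.cos_le_one ⟪t, (p.1 - p.2) • a k⟫]

lemma integral_gaussian_mul_exp_cos_le {d n : ℕ} (hd : 0 < d)
    (a : Fin n → EuclideanSpace ℝ (Fin d)) (hN : (covMat a).PosDef) {M α z : ℝ}
    (hM : 0 < M) (hz : z ≠ 0)
    (h : ∀ (m : Fin n → ℤ) (t : EuclideanSpace ℝ (Fin d)),
      ‖t‖ ≤ Real.sqrt d → (∃ k, (1 / 2 : ℝ) ≤ |⟪t, a k⟫|) → α ^ 2 ≤ ∑ k, (⟪t, a k⟫ - m k) ^ 2) :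
    ∫ t : EuclideanSpace ℝ (Fin d), Real.exp (-(1 / 2) * ‖t‖ ^ 2) *
        Real.exp (-(M / (2 * min (z ^ 2) 1)) * ∑ k, (1 - Real.cos ⟪t, z • a k⟫)) ≤
      Real.exp (d / 2) * Real.sqrt (4 * Real.pi) ^ d *
        (Real.sqrt (Real.pi ^ 3 / M) ^ d * (1 / Real.sqrt (covMat a).det) +
          2 ^ d * Real.exp (-4 * α ^ 2 * M)) := by
  have hπ := Real.pi_pos
  have hz2 : 0 < z ^ 2 := by positivity
  have hm : 0 < min (z ^ 2) 1 := lt_min hz2 one_pos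
  have hmz : min (z ^ 2) 1 ≤ z ^ 2 := min_le_left _ _
  have hm1 : min (z ^ 2) 1 ≤ 1 := min_le_right _ _
  set G : EuclideanSpace ℝ (Fin d) → ℝ := fun t =>
    Real.exp (-(M / (2 * min (z ^ 2) 1)) * ∑ k, (1 - Real.cos ⟪t, z • a k⟫)) with hG
  have hbound := exp_cos_le_of_dist a hM hz h
  set m := min (z ^ 2) 1
  set κ : ℝ := M * z ^ 2 / (Real.pi ^ 2 * m) with hκ
  have hκ0 : 0 < κ := by positivity
  set r : ℝ := max 1 (|z| / (2 * Real.pi)) with hr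
  have hr1 : 1 ≤ r := le_max_left _ _
  have hr0 : 0 < r := by linarith
  have hrm : r ^ 2 * m ≤ z ^ 2 := by
    rcases max_choice 1 (|z| / (2 * Real.pi)) with h1 | h1
    · rw [hr, h1]; linarith
    · rw [hr, h1, div_pow, sq_abs]
      calc z ^ 2 / (2 * Real.pi) ^ 2 * m ≤ z ^ 2 / 1 * 1 := by
            gcongr
            nlinarith [Real.pi_gt_three]
        _ = z ^ 2 := by ring
  set e := Real.exp (-4 * α ^ 2 * M)
  set R : ℝ := Real.sqrt d * (1 / (2 * r)) with hR
  have hsd : 0 < Real.sqrt d := Real.sqrt_pos.2 (by exact_mod_cast hd)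
  have hR0 : 0 < R := by positivity
  have h2R : 2 * R = Real.sqrt d / r := by rw [hR]; field_simp
  have h2Rd : 2 * R ≤ Real.sqrt d := by
    rw [h2R]; exact div_le_self hsd.le hr1
  have hexp1 : ∀ t, G t ≤ 1 := fun t => by
    rw [hG, Real.exp_le_one_iff, neg_mul, neg_nonpos]
    refine mul_nonneg (by positivity) (Finset.sum_nonneg fun k _ => ?_)
    linarith [Real.cos_le_one ⟪t, z • a k⟫]
  have hGc : Continuous G := by fun_prop
  have hmain := measureReal_ball_mul_integral_gaussian_le (G := G)
    (isProbCharFun_exp_cos (fun k => z • a k) (by positivity)) hGc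
    (fun t => (Real.exp_pos _).le) hexp1 hR0 h2Rd
  have hvol : (1 / r) ^ d ≤ volume.real (Metric.closedBall (0 : EuclideanSpace ℝ (Fin d)) R) := by
    have := pow_le_measureReal_closedBall (d := d) (h := 1 / (2 * r)) (by positivity)
    rwa [show 2 * (1 / (2 * r)) = 1 / r by field_simp] at this
  have hvol2 : volume.real (Metric.closedBall (0 : EuclideanSpace ℝ (Fin d)) (2 * R)) =
      2 ^ d * volume.real (Metric.closedBall (0 : EuclideanSpace ℝ (Fin d)) R) := by
    rw [Measure.addHaar_real_closedBall' _ _ hR0.le,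
      Measure.addHaar_real_closedBall' _ _ (by positivity)]
    rw [finrank_euclideanSpace_fin]
    ring_nf
  set V := volume.real (Metric.closedBall (0 : EuclideanSpace ℝ (Fin d)) R)
  have hV0 : 0 < V := lt_of_lt_of_le (by positivity) hvol
  obtain ⟨hqi, hqv⟩ := integrable_and_integral_exp_neg_quadratic a hN hκ0
  have hball : ∫ t in Metric.closedBall 0 (2 * R), G t ≤
      Real.sqrt (Real.pi / κ) ^ d * (1 / Real.sqrt (covMat a).det) + 2 ^ d * V * e := by
    calc ∫ t in Metric.closedBall 0 (2 * R), G t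
        ≤ ∫ t in Metric.closedBall 0 (2 * R),
            (Real.exp (-κ * ∑ k, ⟪t, a k⟫ ^ 2) + e) := by
          refine setIntegral_mono_on
            (hGc.continuousOn.integrableOn_compact (isCompact_closedBall _ _))
            (hqi.integrableOn.add (integrableOn_const measure_closedBall_lt_top.ne))
            Metric.isClosed_closedBall.measurableSet fun t ht => hbound t ?_
          rw [mem_closedBall_zero_iff, h2R, le_div_iff₀ hr0] at ht
          calc _ ≤ r * ‖t‖ := by gcongr; exact le_max_right _ _
            _ ≤ _ := by linarith
      _ = (∫ t in Metric.closedBall 0 (2 * R), Real.exp (-κ * ∑ k, ⟪t, a k⟫ ^ 2)) +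
            2 ^ d * V * e := by
          rw [integral_add hqi.integrableOn (integrableOn_const measure_closedBall_lt_top.ne),
            setIntegral_const, hvol2, smul_eq_mul]
      _ ≤ _ := by
          rw [← hqv]
          have := setIntegral_le_integral (s := Metric.closedBall 0 (2 * R)) hqi
            (Filter.Eventually.of_forall fun t => (Real.exp_pos _).le)
          linarith
  set C := Real.exp (d / 2) * Real.sqrt (4 * Real.pi) ^ d
  set D := 1 / Real.sqrt (covMat a).det
  have hD : 0 ≤ D := by positivity
  have hs : Real.sqrt (Real.pi / κ) * r ≤ Real.sqrt (Real.pi ^ 3 / M) := by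
    rw [← Real.sqrt_sq hr0.le, ← Real.sqrt_mul (by positivity)]
    refine Real.sqrt_le_sqrt ?_
    calc Real.pi / κ * r ^ 2 = Real.pi ^ 3 / M * (r ^ 2 * m / z ^ 2) := by
          rw [hκ]; field_simp
      _ ≤ Real.pi ^ 3 / M * 1 := by
          gcongr
          exact (div_le_one hz2).2 hrm
      _ = _ := mul_one _
  have hpow : Real.sqrt (Real.pi / κ) ^ d ≤ Real.sqrt (Real.pi ^ 3 / M) ^ d * V := by
    calc Real.sqrt (Real.pi / κ) ^ d = (Real.sqrt (Real.pi / κ) * r) ^ d * (1 / r) ^ d := by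
          rw [← mul_pow]; congr 1; field_simp
      _ ≤ _ := by gcongr
  refine le_of_mul_le_mul_left (hmain.trans ?_) hV0
  calc C * ∫ t in Metric.closedBall 0 (2 * R), G t
      ≤ C * (Real.sqrt (Real.pi ^ 3 / M) ^ d * V * D + 2 ^ d * V * e) := by
        refine mul_le_mul_of_nonneg_left (hball.trans ?_) (by positivity)
        gcongr
    _ = _ := by ring

lemma exp_neg_half_integral_le {Ω : Type*} [MeasurableSpace Ω] {P : Measure Ω}
    {f m : Ω → ℝ} {M : ℝ} (hM : 0 < M) (hf : Integrable f P) (hm : Integrable m P)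
    (hmM : ∫ p, m p ∂P = M) (hf0 : ∀ p, 0 ≤ f p) (hm0 : ∀ p, 0 ≤ m p)
    (hfm : ∀ p, m p = 0 → f p = 0) :
    Real.exp (-(1 / 2) * ∫ p, f p ∂P) ≤
      ∫ p, m p / M * Real.exp (-(M / (2 * m p)) * f p) ∂P := by
  set c := -(1 / 2) * ∫ p, f p ∂P with hc
  have hinteg : Integrable (fun p => m p / M * Real.exp (-(M / (2 * m p)) * f p)) P := by
    refine (hm.div_const M).mono' ?_ (Filter.Eventually.of_forall fun p => ?_)
    · have := hm.aestronglyMeasurable.aemeasurable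
      have := hf.aestronglyMeasurable.aemeasurable
      exact AEMeasurable.aestronglyMeasurable (by fun_prop)
    · have h1 := hm0 p
      have h2 := hf0 p
      rw [Real.norm_of_nonneg (by positivity)]
      refine mul_le_of_le_one_right (by positivity) (Real.exp_le_one_iff.2 ?_)
      rw [neg_mul, neg_nonpos]
      positivity
  calc Real.exp c = ∫ p, Real.exp c * ((1 - c) / M * m p - 1 / 2 * f p) ∂P := by
        rw [integral_const_mul, integral_sub (hm.const_mul _) (hf.const_mul _),
          integral_const_mul, integral_const_mul, hmM, div_mul_cancel₀ _ hM.ne']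
        rw [show 1 - c - 1 / 2 * ∫ p, f p ∂P = 1 by rw [hc]; ring, mul_one]
    _ ≤ _ := by
        refine integral_mono (((hm.const_mul _).sub (hf.const_mul _)).const_mul _) hinteg fun p => ?_
        simp only
        rcases (hm0 p).eq_or_lt with h0 | h0
        · simp [← h0, hfm p h0.symm]
        · set y := -(M / (2 * m p)) * f p with hy
          have h1 : Real.exp c * (1 + y - c) ≤ Real.exp y := by
            calc _ ≤ Real.exp c * Real.exp (y - c) := by
                  gcongr; linarith [Real.add_one_le_exp (y - c)]
              _ = _ := by rw [← Real.exp_add]; ring_nf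
          calc _ = m p / M * (Real.exp c * (1 + y - c)) := by
                rw [hy]; field_simp; ring
            _ ≤ _ := by gcongr

lemma integral_gaussian_mul_norm_charFun_sumLaw_le {d n : ℕ} {ν : Measure ℝ}
    [IsProbabilityMeasure ν] (a : Fin n → EuclideanSpace ℝ (Fin d)) (hM : 0 < Mfn ν 1) {B : ℝ}
    (hB : ∀ z : ℝ, z ≠ 0 → ∫ t : EuclideanSpace ℝ (Fin d), Real.exp (-(1 / 2) * ‖t‖ ^ 2) *
        Real.exp (-(Mfn ν 1 / (2 * min (z ^ 2) 1)) * ∑ k, (1 - Real.cos ⟪t, z • a k⟫)) ≤ B) :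
    ∫ t, Real.exp (-(1 / 2) * ‖t‖ ^ 2) * ‖charFun (sumLaw ν a) t‖ ≤ B := by
  set M := Mfn ν 1 with hMdef
  set m : ℝ × ℝ → ℝ := fun p => min ((p.1 - p.2) ^ 2) 1 with hmdef
  have hmM : ∫ p, m p ∂(ν.prod ν) = M := by simp [hMdef, Mfn, hmdef]
  have hm0 : ∀ p, 0 ≤ m p := fun p => le_min (sq_nonneg _) zero_le_one
  have hmc : Continuous m := by fun_prop
  have hmi : Integrable m (ν.prod ν) :=
    Integrable.of_bound (C := 1) hmc.aestronglyMeasurable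
      (Filter.Eventually.of_forall fun p => by
        rw [Real.norm_of_nonneg (hm0 p)]; exact min_le_right _ _)
  set f : EuclideanSpace ℝ (Fin d) → ℝ × ℝ → ℝ :=
    fun t p => ∑ k, (1 - Real.cos ⟪t, (p.1 - p.2) • a k⟫) with hf
  have hf0 : ∀ t p, 0 ≤ f t p := fun t p => Finset.sum_nonneg fun k _ => by
    linarith [Real.cos_le_one ⟪t, (p.1 - p.2) • a k⟫]
  have hfc : Continuous fun q : EuclideanSpace ℝ (Fin d) × (ℝ × ℝ) => f q.1 q.2 := by
    fun_prop
  have hfi : ∀ t, Integrable (f t) (ν.prod ν) := fun t => by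
    refine integrable_finsetSum _ fun k _ => ?_
    refine Integrable.of_bound (C := 2) (Continuous.aestronglyMeasurable (by fun_prop))
      (Filter.Eventually.of_forall fun p => ?_)
    rw [Real.norm_eq_abs, abs_le]
    constructor <;> linarith [Real.neg_one_le_cos ⟪t, (p.1 - p.2) • a k⟫,
      Real.cos_le_one ⟪t, (p.1 - p.2) • a k⟫]
  have hmz : ∀ p, m p = 0 → p.1 - p.2 = 0 := fun p hp => by
    rcases min_choice ((p.1 - p.2) ^ 2) 1 with h1 | h1
    · exact pow_eq_zero_iff two_ne_zero |>.1 (h1.symm.trans hp)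
    · exact absurd (h1.symm.trans hp) one_ne_zero
  set F : EuclideanSpace ℝ (Fin d) → ℝ × ℝ → ℝ := fun t p =>
    Real.exp (-(1 / 2) * ‖t‖ ^ 2) * (m p / M * Real.exp (-(M / (2 * m p)) * f t p)) with hF
  have hgauss : Integrable fun t : EuclideanSpace ℝ (Fin d) => Real.exp (-(1 / 2) * ‖t‖ ^ 2) :=
    integrable_exp_neg_mul_norm_sq (by norm_num)
  have hFi : Integrable (Function.uncurry F) (volume.prod (ν.prod ν)) := by
    refine (hgauss.mul_prod (hmi.div_const M)).mono' ?_ (Filter.Eventually.of_forall fun q => ?_)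
    · have := hfc.measurable
      have := hmc.measurable
      refine Measurable.aestronglyMeasurable ?_
      simp only [Function.uncurry_def, hF]
      fun_prop
    · have h1 := hm0 q.2
      have h2 := hf0 q.1 q.2
      simp only [Function.uncurry_def, hF]
      rw [Real.norm_of_nonneg (by positivity)]
      refine mul_le_mul_of_nonneg_left (mul_le_of_le_one_right (by positivity)
        (Real.exp_le_one_iff.2 ?_)) (Real.exp_pos _).le
      rw [neg_mul, neg_nonpos]
      positivity
  calc ∫ t, Real.exp (-(1 / 2) * ‖t‖ ^ 2) * ‖charFun (sumLaw ν a) t‖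
      ≤ ∫ t, ∫ p, F t p ∂(ν.prod ν) := by
        refine integral_mono_of_nonneg (Filter.Eventually.of_forall fun t => by positivity)
          hFi.integral_prod_left (Filter.Eventually.of_forall fun t => ?_)
        simp only [hF]
        rw [integral_const_mul]
        refine mul_le_mul_of_nonneg_left ((norm_charFun_sumLaw_le_exp a t).trans ?_)
          (Real.exp_pos _).le
        refine exp_neg_half_integral_le hM (hfi t) hmi hmM (hf0 t) hm0 fun p hp => ?_
        simp [hmz p hp]
    _ = ∫ p, (∫ t, F t p) ∂(ν.prod ν) := integral_integral_swap hFi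
    _ ≤ ∫ p, m p / M * B ∂(ν.prod ν) := by
        refine integral_mono hFi.integral_prod_right ((hmi.div_const M).mul_const B) fun p => ?_
        simp only [hF]
        simp_rw [mul_left_comm _ (m p / M)]
        rw [integral_const_mul]
        by_cases hz : p.1 - p.2 = 0
        · simp [hmdef, hz]
        · exact mul_le_mul_of_nonneg_left (hB _ hz) (div_nonneg (hm0 p) hM.le)
    _ = B := by
        rw [integral_mul_const, integral_div, hmM, div_self hM.ne', one_mul]

theorem stmt_0 :
    ∃ c₁ c₂ : ℝ, 0 < c₁ ∧ 0 < c₂ ∧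
      ∀ (d n : ℕ), 0 < d →
      ∀ (ν : Measure ℝ), IsProbabilityMeasure ν →
      ∀ (a : Fin n → EuclideanSpace ℝ (Fin d)),
      (covMat a).PosDef →
      0 < Mfn ν 1 →
      ∀ α : ℝ, 0 < α →
      (∀ (m : Fin n → ℤ) (t : EuclideanSpace ℝ (Fin d)),
        ‖t‖ ≤ Real.sqrt d → (∃ k, (1 / 2 : ℝ) ≤ |⟪t, a k⟫|) →
        α ^ 2 ≤ ∑ k, (⟪t, a k⟫ - m k) ^ 2) →
      concFn (sumLaw ν a) (Real.sqrt d) ≤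
        c₁ ^ d * ((1 / Real.sqrt (Mfn ν 1)) ^ d * (1 / Real.sqrt (covMat a).det)
          + Real.exp (-c₂ * α ^ 2 * Mfn ν 1)) := by
  have hπ := Real.pi_pos
  set A : ℝ := Real.exp (1 / 2) * (1 / Real.sqrt (2 * Real.pi)) *
    (Real.exp (1 / 2) * Real.sqrt (4 * Real.pi)) with hA
  refine ⟨A * (Real.sqrt (Real.pi ^ 3) + 2), 4, by positivity, by norm_num, ?_⟩
  intro d n hd ν hν a hN hM α _ h
  have : IsProbabilityMeasure (sumLaw ν a) :=
    Measure.isProbabilityMeasure_map (Continuous.aemeasurable (by fun_prop))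
  have hexp : Real.exp (d / 2) = Real.exp (1 / 2) ^ d := by
    rw [← Real.exp_nat_mul]; congr 1; ring
  have h1 := concFn_sqrt_le_integral_norm_charFun (sumLaw ν a)
  have h2 := integral_gaussian_mul_norm_charFun_sumLaw_le a hM
    fun z hz => integral_gaussian_mul_exp_cos_le hd a hN hM hz h
  set M := Mfn ν 1
  set D := 1 / Real.sqrt (covMat a).det
  set e := Real.exp (-4 * α ^ 2 * M)
  have hD : 0 ≤ D := by positivity
  calc concFn (sumLaw ν a) (Real.sqrt d)
      ≤ _ := h1
    _ ≤ Real.exp (d / 2) * (1 / Real.sqrt (2 * Real.pi)) ^ d *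
        (Real.exp (d / 2) * Real.sqrt (4 * Real.pi) ^ d *
          (Real.sqrt (Real.pi ^ 3 / M) ^ d * D + 2 ^ d * e)) := by gcongr
    _ = A ^ d * (Real.sqrt (Real.pi ^ 3) ^ d * ((1 / Real.sqrt M) ^ d * D) + 2 ^ d * e) := by
        rw [hexp, Real.sqrt_div (by positivity), div_eq_mul_one_div (Real.sqrt (Real.pi ^ 3)),
          mul_pow (Real.sqrt (Real.pi ^ 3)), hA]
        simp only [mul_pow]
        ring
    _ ≤ A ^ d * ((Real.sqrt (Real.pi ^ 3) + 2) ^ d * ((1 / Real.sqrt M) ^ d * D) +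
          (Real.sqrt (Real.pi ^ 3) + 2) ^ d * e) := by
        gcongr
        · linarith
        · linarith [Real.sqrt_nonneg (Real.pi ^ 3)]
    _ = _ := by rw [mul_pow A]; ring
end

section
/- Let X, X₁, …, Xₙ be i.i.d. real-valued random variables with M(1) > 0, and let a = (a₁, …, aₙ) with aₖ ∈ ℝ^d be such that 𝑁 = Σₖ aₖaₖᵀ is positive definite. Let D > 0 and α > 0, and suppose Σₖ(⟨t,aₖ⟩ − mₖ)² ≥ α² for all integers m₁, …, mₙ and all t ∈ ℝ^d with ‖t‖ ≤ D and maxₖ|⟨t,aₖ⟩| ≥ 1/2. Then there exist absolute constants c₁, c₂ > 0 such that Q(F_a, d/D) ≤ c₁^d ( (√d/(D √M(1)))^d (det 𝑁)^{-1/2} + exp(−c₂ α² M(1)) ). -/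
open MeasureTheory
open scoped RealInnerProductSpace

section GaussianAverages

variable {V : Type*} [NormedAddCommGroup V] [InnerProductSpace ℝ V] [FiniteDimensional ℝ V]
  [MeasurableSpace V] [BorelSpace V]

lemma integrable_gaussianWeight {b : ℝ} (hb : 0 < b) :
    Integrable (fun u : V => Real.exp (-b * ‖u‖ ^ 2)) := by
  have h := GaussianFourier.integrable_cexp_neg_mul_sq_norm_add (V := V) (b := (b : ℂ))
    (by simpa using hb) 0 0
  refine h.norm.congr (Filter.Eventually.of_forall fun u => ?_)
  simp [Complex.norm_exp, ← Complex.ofReal_pow]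

lemma integrable_gaussianWeight_mul {b C : ℝ} (hb : 0 < b) {ψ : V → ℝ}
    (hψ : AEStronglyMeasurable ψ) (hC : ∀ t, |ψ t| ≤ C) :
    Integrable (fun u : V => Real.exp (-b * ‖u‖ ^ 2) * ψ u) :=
  (integrable_gaussianWeight hb).mul_bdd hψ (Filter.Eventually.of_forall hC)

lemma integral_gaussianWeight_mul_cos (w : V) :
    ∫ u : V, Real.exp (-(1 / 2) * ‖u‖ ^ 2) * Real.cos ⟪u, w⟫ =
      (2 * Real.pi) ^ (Module.finrank ℝ V / 2 : ℝ) * Real.exp (-(‖w‖ ^ 2 / 2)) := by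
  have h := GaussianFourier.integral_cexp_neg_mul_sq_norm_add (V := V) (b := ((1 / 2 : ℝ) : ℂ))
    (by norm_num) Complex.I w
  have h2 := congrArg Complex.re h
  have hi := GaussianFourier.integrable_cexp_neg_mul_sq_norm_add (V := V) (b := ((1 / 2 : ℝ) : ℂ))
    (by norm_num) Complex.I w
  have h3 := integral_re (𝕜 := ℂ) hi
  simp only [RCLike.re_eq_complex_re] at h3
  rw [← h3] at h2
  convert h2 using 1
  · refine integral_congr_ae (Filter.Eventually.of_forall fun u => ?_)
    simp only [Complex.exp_re]
    simp [← Complex.ofReal_pow, real_inner_comm]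
  · have e1 : (Real.pi / ((1 / 2 : ℝ) : ℂ)) ^ (Module.finrank ℝ V / 2 : ℂ)
        = (((2 * Real.pi) ^ (Module.finrank ℝ V / 2 : ℝ) : ℝ) : ℂ) := by
      rw [Complex.ofReal_cpow (by positivity)]
      push_cast
      congr 1
      ring
    have e2 : Complex.exp (Complex.I ^ 2 * (‖w‖ : ℂ) ^ 2 / (4 * ((1 / 2 : ℝ) : ℂ)))
        = ((Real.exp (-(‖w‖ ^ 2 / 2)) : ℝ) : ℂ) := by
      push_cast
      congr 1
      rw [Complex.I_sq]; ring
    rw [e1, e2, ← Complex.ofReal_mul, Complex.ofReal_re]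

/-- Bounded continuous functions all of whose cosine modulations have Gaussian averages
decreasing in the scale of the Gaussian. -/
structure GaussDecreasing (ψ : V → ℝ) : Prop where
  continuous : Continuous ψ
  bounded : ∃ C, ∀ t, |ψ t| ≤ C
  average_le : ∀ (b : V) (σ τ : ℝ), 0 ≤ σ → σ ≤ τ →
    ∫ u : V, Real.exp (-(1 / 2) * ‖u‖ ^ 2) * (ψ (τ • u) * Real.cos ⟪τ • u, b⟫) ≤
      ∫ u : V, Real.exp (-(1 / 2) * ‖u‖ ^ 2) * (ψ (σ • u) * Real.cos ⟪σ • u, b⟫)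

namespace GaussDecreasing

lemma integrable {ψ : V → ℝ} (hψ : Continuous ψ) (hC : ∃ C, ∀ t, |ψ t| ≤ C) (b : V) (σ : ℝ) :
    Integrable fun u : V =>
      Real.exp (-(1 / 2) * ‖u‖ ^ 2) * (ψ (σ • u) * Real.cos ⟪σ • u, b⟫) := by
  obtain ⟨C, hC⟩ := hC
  refine integrable_gaussianWeight_mul (C := C) (by norm_num)
    (by fun_prop) fun t => ?_
  rw [abs_mul]
  exact (mul_le_of_le_one_right (abs_nonneg _) (Real.abs_cos_le_one _)).trans (hC _)

lemma one : GaussDecreasing (fun _ : V => (1 : ℝ)) where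
  continuous := continuous_const
  bounded := ⟨1, by simp⟩
  average_le b σ τ hσ hστ := by
    have key (ρ : ℝ) := integral_gaussianWeight_mul_cos (ρ • b)
    simp only [one_mul, real_inner_smul_left, real_inner_smul_right] at key ⊢
    rw [key, key]
    gcongr
    simp only [norm_smul, Real.norm_eq_abs, abs_of_nonneg hσ, abs_of_nonneg (hσ.trans hστ)]
    gcongr

lemma add {ψ φ : V → ℝ} (hψ : GaussDecreasing ψ) (hφ : GaussDecreasing φ) :
    GaussDecreasing (fun t => ψ t + φ t) where
  continuous := hψ.continuous.add hφ.continuous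
  bounded := by
    obtain ⟨C, hC⟩ := hψ.bounded
    obtain ⟨C', hC'⟩ := hφ.bounded
    exact ⟨C + C', fun t => (abs_add_le _ _).trans (add_le_add (hC t) (hC' t))⟩
  average_le b σ τ hσ hστ := by
    simp only [add_mul, mul_add]
    rw [integral_add (integrable hψ.continuous hψ.bounded b τ)
      (integrable hφ.continuous hφ.bounded b τ),
      integral_add (integrable hψ.continuous hψ.bounded b σ)
      (integrable hφ.continuous hφ.bounded b σ)]
    exact add_le_add (hψ.average_le b σ τ hσ hστ) (hφ.average_le b σ τ hσ hστ)

lemma const_mul {ψ : V → ℝ} (hψ : GaussDecreasing ψ) {c : ℝ} (hc : 0 ≤ c) :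
    GaussDecreasing (fun t => c * ψ t) where
  continuous := hψ.continuous.const_mul c
  bounded := by
    obtain ⟨C, hC⟩ := hψ.bounded
    refine ⟨c * C, fun t => ?_⟩
    rw [abs_mul, abs_of_nonneg hc]
    exact mul_le_mul_of_nonneg_left (hC t) hc
  average_le b σ τ hσ hστ := by
    have h (ρ : ℝ) (u : V) : Real.exp (-(1 / 2) * ‖u‖ ^ 2) *
        (c * ψ (ρ • u) * Real.cos ⟪ρ • u, b⟫) =
        c * (Real.exp (-(1 / 2) * ‖u‖ ^ 2) * (ψ (ρ • u) * Real.cos ⟪ρ • u, b⟫)) := by ring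
    simp only [h, integral_const_mul]
    exact mul_le_mul_of_nonneg_left (hψ.average_le b σ τ hσ hστ) hc

lemma mul_cos {ψ : V → ℝ} (hψ : GaussDecreasing ψ) (a : V) :
    GaussDecreasing (fun t => ψ t * Real.cos ⟪t, a⟫) where
  continuous := hψ.continuous.mul (by fun_prop)
  bounded := by
    obtain ⟨C, hC⟩ := hψ.bounded
    refine ⟨C, fun t => ?_⟩
    rw [abs_mul]
    exact (mul_le_of_le_one_right (abs_nonneg _) (Real.abs_cos_le_one _)).trans (hC _)
  average_le b σ τ hσ hστ := by
    have h (ρ : ℝ) (u : V) : Real.exp (-(1 / 2) * ‖u‖ ^ 2) *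
        (ψ (ρ • u) * Real.cos ⟪ρ • u, a⟫ * Real.cos ⟪ρ • u, b⟫) =
        1 / 2 * (Real.exp (-(1 / 2) * ‖u‖ ^ 2) * (ψ (ρ • u) * Real.cos ⟪ρ • u, a + b⟫) +
        Real.exp (-(1 / 2) * ‖u‖ ^ 2) * (ψ (ρ • u) * Real.cos ⟪ρ • u, a - b⟫)) := by
      rw [inner_add_right, inner_sub_right, Real.cos_add, Real.cos_sub]; ring
    simp only [h, integral_const_mul]
    rw [integral_add (integrable hψ.continuous hψ.bounded _ τ)
      (integrable hψ.continuous hψ.bounded _ τ),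
      integral_add (integrable hψ.continuous hψ.bounded _ σ)
      (integrable hψ.continuous hψ.bounded _ σ)]
    have := hψ.average_le (a + b) σ τ hσ hστ
    have := hψ.average_le (a - b) σ τ hσ hστ
    linarith

lemma of_tendsto {Ψ : ℕ → V → ℝ} {ψ : V → ℝ} (hΨ : ∀ m, GaussDecreasing (Ψ m))
    (hψ : Continuous ψ) {C : ℝ} (hC : ∀ m t, |Ψ m t| ≤ C)
    (hlim : ∀ t, Filter.Tendsto (fun m => Ψ m t) Filter.atTop (nhds (ψ t))) :
    GaussDecreasing ψ where
  continuous := hψ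
  bounded := ⟨C, fun t => le_of_tendsto' (hlim t).abs fun m => hC m t⟩
  average_le b σ τ hσ hστ := by
    have key (ρ : ℝ) : Filter.Tendsto (fun m => ∫ u : V, Real.exp (-(1 / 2) * ‖u‖ ^ 2) *
        (Ψ m (ρ • u) * Real.cos ⟪ρ • u, b⟫)) Filter.atTop
        (nhds (∫ u : V, Real.exp (-(1 / 2) * ‖u‖ ^ 2) *
          (ψ (ρ • u) * Real.cos ⟪ρ • u, b⟫))) := by
      refine tendsto_integral_of_dominated_convergence
        (fun u => Real.exp (-(1 / 2) * ‖u‖ ^ 2) * C)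
        (fun m => (integrable (hΨ m).continuous (hΨ m).bounded b ρ).aestronglyMeasurable)
        ((integrable_gaussianWeight (by norm_num)).mul_const C)
        (fun m => Filter.Eventually.of_forall fun u => ?_)
        (Filter.Eventually.of_forall fun u => ((hlim _).mul_const _).const_mul _)
      rw [Real.norm_eq_abs, abs_mul, Real.abs_exp, abs_mul]
      gcongr
      exact (mul_le_of_le_one_right (abs_nonneg _) (Real.abs_cos_le_one _)).trans (hC _ _)
    exact le_of_tendsto_of_tendsto' (key τ) (key σ)
      fun m => (hΨ m).average_le b σ τ hσ hστ

lemma mul_cos_pow {ψ : V → ℝ} (hψ : GaussDecreasing ψ) (a : V) (m : ℕ) :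
    GaussDecreasing (fun t => ψ t * Real.cos ⟪t, a⟫ ^ m) := by
  induction m with
  | zero => simpa using hψ
  | succ m ih => simpa [pow_succ, mul_assoc] using ih.mul_cos a

lemma mul_exp_cos {ψ : V → ℝ} (hψ : GaussDecreasing ψ) (a : V) {c : ℝ} (hc : 0 ≤ c) :
    GaussDecreasing (fun t => ψ t * Real.exp (c * Real.cos ⟪t, a⟫)) := by
  obtain ⟨C, hC⟩ := hψ.bounded
  have hpart (t : V) (m : ℕ) : |∑ i ∈ Finset.range m, (c * Real.cos ⟪t, a⟫) ^ i / i.factorial|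
      ≤ Real.exp c := by
    refine (Finset.abs_sum_le_sum_abs _ _).trans (le_trans ?_ (Real.sum_le_exp_of_nonneg hc m))
    refine Finset.sum_le_sum fun i _ => ?_
    rw [abs_div, abs_pow, abs_mul, abs_of_nonneg hc, Nat.abs_cast]
    gcongr
    exact mul_le_of_le_one_right hc (Real.abs_cos_le_one _)
  refine of_tendsto (C := C * Real.exp c)
    (Ψ := fun m t => ψ t * ∑ i ∈ Finset.range m, (c * Real.cos ⟪t, a⟫) ^ i / i.factorial)
    (fun m => ?_) (hψ.continuous.mul (by fun_prop)) (fun m t => ?_) (fun t => ?_)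
  · induction m with
    | zero => simpa using hψ.const_mul le_rfl
    | succ m ih =>
      simp only [Finset.sum_range_succ, mul_add]
      refine ih.add ?_
      have := (hψ.mul_cos_pow a m).const_mul (c := c ^ m / m.factorial) (by positivity)
      convert this using 2 with t
      rw [mul_pow]; ring
  · rw [abs_mul]
    exact mul_le_mul (hC t) (hpart t m) (abs_nonneg _) ((abs_nonneg _).trans (hC t))
  · refine Filter.Tendsto.const_mul _ ?_
    have := (NormedSpace.expSeries_div_hasSum_exp (c * Real.cos ⟪t, a⟫)).tendsto_sum_nat
    rwa [← Real.exp_eq_exp_ℝ] at this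

lemma exp_sum_cos {ι : Type*} (s : Finset ι) (a : ι → V) {c : ℝ} (hc : 0 ≤ c) :
    GaussDecreasing (fun t => Real.exp (-(c * ∑ k ∈ s, (1 - Real.cos ⟪t, a k⟫)))) := by
  classical
  induction s using Finset.induction_on with
  | empty => simpa using one
  | insert k s hk ih =>
    have := (ih.mul_exp_cos (a k) hc).const_mul (Real.exp_pos (-c)).le
    convert this using 2 with t
    rw [Finset.sum_insert hk, ← Real.exp_add, ← Real.exp_add]
    congr 1
    ring

lemma average_le' {ψ : V → ℝ} (hψ : GaussDecreasing ψ) {σ τ : ℝ} (hσ : 0 ≤ σ) (hστ : σ ≤ τ) :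
    ∫ u : V, Real.exp (-(1 / 2) * ‖u‖ ^ 2) * ψ (τ • u) ≤
      ∫ u : V, Real.exp (-(1 / 2) * ‖u‖ ^ 2) * ψ (σ • u) := by
  simpa using hψ.average_le 0 σ τ hσ hστ

end GaussDecreasing
end GaussianAverages

section Truncation

variable {V : Type*} [NormedAddCommGroup V] [InnerProductSpace ℝ V] [FiniteDimensional ℝ V]
  [MeasurableSpace V] [BorelSpace V]

lemma exp_neg_four_mul_sqrt_two_pow_le {d : ℕ} (hd : 0 < d) :
    Real.exp (-(4 * d)) * Real.sqrt 2 ^ d ≤ 1 / 2 := by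
  have h1 : Real.exp (-4) ≤ 1 / 5 := by
    rw [Real.exp_neg, one_div]
    gcongr
    have := Real.add_one_le_exp (4 : ℝ)
    linarith
  have h2 : Real.sqrt 2 ≤ 3 / 2 := Real.sqrt_le_iff.2 (by norm_num)
  have h3 : Real.exp (-(4 * d)) = Real.exp (-4) ^ d := by
    rw [← Real.exp_nat_mul]; congr 1; ring
  rw [h3, ← mul_pow]
  have h4 : Real.exp (-4) * Real.sqrt 2 ≤ 1 / 2 := by
    have := mul_le_mul h1 h2 (Real.sqrt_nonneg 2) (by norm_num)
    linarith
  exact (pow_le_of_le_one (by positivity) (by linarith) hd.ne').trans h4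

lemma GaussDecreasing.average_le_two_mul_setIntegral {ψ : V → ℝ} (hψ : GaussDecreasing ψ)
    (hpos : ∀ t, 0 ≤ ψ t) {σ : ℝ} (hσ : 0 ≤ σ) (hd : 0 < Module.finrank ℝ V) :
    ∫ u : V, Real.exp (-(1 / 2) * ‖u‖ ^ 2) * ψ (σ • u) ≤
      2 * ∫ u in {u : V | ‖u‖ ^ 2 ≤ 16 * Module.finrank ℝ V},
        Real.exp (-(1 / 2) * ‖u‖ ^ 2) * ψ (σ • u) := by
  set d := Module.finrank ℝ V
  set s : Set V := {u : V | ‖u‖ ^ 2 ≤ 16 * d}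
  have hs : MeasurableSet s := measurableSet_le (by fun_prop) (by fun_prop)
  obtain ⟨C, hC⟩ := hψ.bounded
  have hcont := hψ.continuous
  have hint (b : ℝ) (hb : 0 < b) :
      Integrable fun u : V => Real.exp (-b * ‖u‖ ^ 2) * ψ (σ • u) :=
    integrable_gaussianWeight_mul hb (by fun_prop) fun t => hC _
  set I := ∫ u : V, Real.exp (-(1 / 2) * ‖u‖ ^ 2) * ψ (σ • u)
  have hwide : ∫ u : V, Real.exp (-(1 / 4) * ‖u‖ ^ 2) * ψ (σ • u) ≤ Real.sqrt 2 ^ d * I := by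
    have h := Measure.integral_comp_smul (volume : Measure V)
      (fun u : V => Real.exp (-(1 / 4) * ‖u‖ ^ 2) * ψ (σ • u)) (Real.sqrt 2)
    have h' : ∫ u : V, Real.exp (-(1 / 4) * ‖Real.sqrt 2 • u‖ ^ 2) * ψ (σ • Real.sqrt 2 • u) ≤ I := by
      have := hψ.average_le' hσ (τ := σ * Real.sqrt 2)
        (le_mul_of_one_le_right hσ (Real.one_le_sqrt.2 (by norm_num)))
      refine le_trans (le_of_eq (integral_congr_ae (Filter.Eventually.of_forall fun u => ?_))) this
      have e : -(1 / 4) * ‖Real.sqrt 2 • u‖ ^ 2 = -(1 / 2) * ‖u‖ ^ 2 := by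
        rw [norm_smul, mul_pow, Real.norm_eq_abs, sq_abs, Real.sq_sqrt (by norm_num)]; ring
      simp only [e, smul_smul]
    rw [h, smul_eq_mul, abs_of_nonneg (by positivity), inv_mul_le_iff₀ (by positivity)] at h'
    exact h'
  have htail : ∫ u in sᶜ, Real.exp (-(1 / 2) * ‖u‖ ^ 2) * ψ (σ • u) ≤
      Real.exp (-(4 * d)) * ∫ u : V, Real.exp (-(1 / 4) * ‖u‖ ^ 2) * ψ (σ • u) := by
    rw [← integral_const_mul]
    refine (setIntegral_mono_on (hint _ (by norm_num)).integrableOn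
      ((hint (1 / 4) (by norm_num)).const_mul (Real.exp (-(4 * d)))).integrableOn hs.compl
      fun u hu => ?_).trans
      (setIntegral_le_integral ((hint (1 / 4) (by norm_num)).const_mul _)
        (Filter.Eventually.of_forall fun u => mul_nonneg (Real.exp_pos _).le
          (mul_nonneg (Real.exp_pos _).le (hpos _))))
    rw [← mul_assoc, ← Real.exp_add]
    refine mul_le_mul_of_nonneg_right (Real.exp_le_exp.2 ?_) (hpos _)
    have : 16 * (d : ℝ) < ‖u‖ ^ 2 := not_le.1 hu
    linarith
  have hI : 0 ≤ I := integral_nonneg fun u => mul_nonneg (Real.exp_pos _).le (hpos _)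
  have hsplit := integral_add_compl hs (hint (1 / 2) (by norm_num))
  have hhalf : Real.exp (-(4 * d)) * (Real.sqrt 2 ^ d * I) ≤ 1 / 2 * I := by
    rw [← mul_assoc]
    exact mul_le_mul_of_nonneg_right (exp_neg_four_mul_sqrt_two_pow_le hd) hI
  have := mul_le_mul_of_nonneg_left hwide (Real.exp_pos (-(4 * (d : ℝ)))).le
  linarith

end Truncation

section QuadraticForm

variable {d n : ℕ}

lemma exists_linearMap_covMat (a : Fin n → EuclideanSpace ℝ (Fin d)) (ha : (covMat a).PosDef) :
    ∃ f : EuclideanSpace ℝ (Fin d) →ₗ[ℝ] EuclideanSpace ℝ (Fin d),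
      LinearMap.det f = Real.sqrt (covMat a).det ∧ ∀ u, ‖f u‖ ^ 2 = ∑ k, ⟪u, a k⟫ ^ 2 := by
  open scoped MatrixOrder in
  have hps := ha.posSemidef
  set B := CFC.sqrt (covMat a) with hB
  have hBh : B.conjTranspose = B := (Matrix.nonneg_iff_posSemidef.1 (CFC.sqrt_nonneg (covMat a))).1
  have hBB : B * B = covMat a := CFC.sqrt_mul_sqrt_self _ hps.nonneg
  refine ⟨Matrix.toLpLin 2 2 B, ?_, fun u => ?_⟩
  · rw [LinearMap.det_toLpLin, hB, hps.det_sqrt]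
    simp
  · have h1 : ‖Matrix.toLpLin 2 2 B u‖ ^ 2 =
        dotProduct (B.mulVec u.ofLp) (B.mulVec u.ofLp) := by
      rw [EuclideanSpace.norm_sq_eq]
      simp [Matrix.toLpLin_apply, dotProduct, sq]
    have h2 : dotProduct (B.mulVec u.ofLp) (B.mulVec u.ofLp) =
        dotProduct u.ofLp ((covMat a).mulVec u.ofLp) := by
      rw [← hBB, ← Matrix.mulVec_mulVec, Matrix.dotProduct_mulVec u.ofLp B]
      congr 1
      rw [← Matrix.mulVec_transpose]
      congr 1
      rw [← Matrix.conjTranspose_eq_transpose_of_trivial, hBh]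
    rw [h1, h2]
    have h3 (k : Fin n) : ⟪u, a k⟫ = ∑ i, u i * a k i := by
      simp [PiLp.inner_apply, mul_comm]
    simp only [h3, sq, dotProduct, Matrix.mulVec, covMat, Matrix.of_apply,
      Finset.sum_mul, Finset.mul_sum]
    conv_lhs => rw [Finset.sum_comm]
    conv_rhs => rw [Finset.sum_comm]
    refine Finset.sum_congr rfl fun j _ => ?_
    rw [Finset.sum_comm]
    exact Finset.sum_congr rfl fun k _ => Finset.sum_congr rfl fun i _ => by ring

lemma quadratic_gaussian (a : Fin n → EuclideanSpace ℝ (Fin d)) (ha : (covMat a).PosDef)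
    {c : ℝ} (hc : 0 < c) :
    Integrable (fun u : EuclideanSpace ℝ (Fin d) => Real.exp (-c * ∑ k, ⟪u, a k⟫ ^ 2)) ∧
    ∫ u : EuclideanSpace ℝ (Fin d), Real.exp (-c * ∑ k, ⟪u, a k⟫ ^ 2) =
      (1 / Real.sqrt (covMat a).det) * (Real.pi / c) ^ (d / 2 : ℝ) := by
  obtain ⟨f, hdet, hf⟩ := exists_linearMap_covMat a ha
  have hpos : 0 < Real.sqrt (covMat a).det := Real.sqrt_pos.2 ha.det_pos
  have hmap := Measure.map_linearMap_addHaar_eq_smul_addHaar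
    (volume : Measure (EuclideanSpace ℝ (Fin d))) (f := f) (by rw [hdet]; exact hpos.ne')
  have hfm : AEMeasurable f (volume : Measure (EuclideanSpace ℝ (Fin d))) :=
    f.continuous_of_finiteDimensional.aemeasurable
  have hg := integrable_gaussianWeight (V := EuclideanSpace ℝ (Fin d)) hc
  simp only [← hf]
  have hcont : Continuous fun u : EuclideanSpace ℝ (Fin d) => Real.exp (-c * ‖u‖ ^ 2) := by
    fun_prop
  constructor
  · have : Integrable (fun u : EuclideanSpace ℝ (Fin d) => Real.exp (-c * ‖u‖ ^ 2))
        (Measure.map f volume) := by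
      rw [hmap]
      exact hg.smul_measure ENNReal.ofReal_ne_top
    exact this.comp_aemeasurable hfm
  · rw [← integral_map (f := fun u => Real.exp (-c * ‖u‖ ^ 2)) hfm hcont.aestronglyMeasurable,
      hmap, integral_smul_measure, GaussianFourier.integral_rexp_neg_mul_sq_norm hc,
      hdet, ENNReal.toReal_ofReal (abs_nonneg _), abs_of_nonneg (by positivity)]
    simp

end QuadraticForm

section Cosine

lemma eight_mul_sq_le_one_sub_cos {y : ℝ} (hy : |y| ≤ 1 / 2) :
    8 * y ^ 2 ≤ 1 - Real.cos (2 * Real.pi * y) := by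
  have h := Real.cos_le_one_sub_mul_cos_sq (x := 2 * Real.pi * y) (by
    rw [abs_mul, abs_of_pos (by positivity)]
    nlinarith [Real.pi_pos])
  have : 2 / Real.pi ^ 2 * (2 * Real.pi * y) ^ 2 = 8 * y ^ 2 := by
    field_simp; ring
  linarith

lemma eight_mul_sub_round_sq_le (y : ℝ) :
    8 * (y - round y) ^ 2 ≤ 1 - Real.cos (2 * Real.pi * y) := by
  have h := eight_mul_sq_le_one_sub_cos (abs_sub_round y)
  have e : 2 * Real.pi * (y - round y) = 2 * Real.pi * y - round y * (2 * Real.pi) := by ring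
  rwa [e, Real.cos_sub_int_mul_two_pi] at h

end Cosine

section ScaleBound

variable {d n : ℕ}

lemma truncated_integrand_le {a : Fin n → EuclideanSpace ℝ (Fin d)} (hd : 0 < d)
    {M D α z : ℝ} (hM : 0 < M) (hD : 0 < D)
    (h : ∀ (m : Fin n → ℤ) (t : EuclideanSpace ℝ (Fin d)),
        ‖t‖ ≤ D → (∃ k, (1 / 2 : ℝ) ≤ |⟪t, a k⟫|) →
        α ^ 2 ≤ ∑ k, (⟪t, a k⟫ - m k) ^ 2)
    (hz : 0 < z) (hz1 : z ≤ 1) {u : EuclideanSpace ℝ (Fin d)} (hu : ‖u‖ ^ 2 ≤ 16 * d) :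
    Real.exp (-(1 / 2) * ‖u‖ ^ 2) * Real.exp (-(M / (2 * z ^ 2) *
        ∑ k, (1 - Real.cos ⟪(z * (D / (4 * Real.sqrt d))) • u, a k⟫))) ≤
      Real.exp (-(1 / 2) * ‖u‖ ^ 2) * Real.exp (-(4 * M * α ^ 2)) +
        Real.exp (-(M * (D / (4 * Real.sqrt d)) ^ 2 / Real.pi ^ 2) * ∑ k, ⟪u, a k⟫ ^ 2) := by
  set σ := D / (4 * Real.sqrt d) with hσdef
  have hsd : 0 < Real.sqrt d := Real.sqrt_pos.2 (by exact_mod_cast hd)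
  have hσ : 0 < σ := by positivity
  set t : EuclideanSpace ℝ (Fin d) := (z * σ / (2 * Real.pi)) • u with ht
  have hinner (k : Fin n) : ⟪(z * σ) • u, a k⟫ = 2 * Real.pi * ⟪t, a k⟫ := by
    rw [ht, real_inner_smul_left, real_inner_smul_left]
    field_simp
  have htD : ‖t‖ ≤ D := by
    have hu' : ‖u‖ ≤ 4 * Real.sqrt d := by
      refine abs_le_of_sq_le_sq' ?_ (by positivity) |>.2
      rw [mul_pow, Real.sq_sqrt (by positivity)]
      linarith
    have hzp : z / (2 * Real.pi) ≤ 1 := by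
      rw [div_le_one (by positivity)]
      linarith [Real.pi_gt_three]
    calc ‖t‖ = z / (2 * Real.pi) * (σ * ‖u‖) := by
          rw [ht, norm_smul, Real.norm_eq_abs, abs_of_pos (by positivity)]; ring
      _ ≤ 1 * (σ * (4 * Real.sqrt d)) := by gcongr
      _ = D := by rw [hσdef]; field_simp
  simp only [hinner]
  by_cases hk : ∃ k, (1 / 2 : ℝ) ≤ |⟪t, a k⟫|
  · have h1 := h (fun k => round ⟪t, a k⟫) t htD hk
    have h2 : 8 * α ^ 2 ≤ ∑ k, (1 - Real.cos (2 * Real.pi * ⟪t, a k⟫)) := by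
      refine (mul_le_mul_of_nonneg_left h1 (by norm_num)).trans ?_
      rw [Finset.mul_sum]
      exact Finset.sum_le_sum fun k _ => eight_mul_sub_round_sq_le _
    have h3 : M / 2 ≤ M / (2 * z ^ 2) := by
      gcongr
      nlinarith
    have h4 : 4 * M * α ^ 2 ≤
        M / (2 * z ^ 2) * ∑ k, (1 - Real.cos (2 * Real.pi * ⟪t, a k⟫)) := by
      refine le_trans (le_of_eq ?_) (mul_le_mul h3 h2 (by positivity) (by positivity))
      ring
    refine le_add_of_le_of_nonneg ?_ (Real.exp_pos _).le
    gcongr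
  · push Not at hk
    have h2 : 8 * ∑ k, ⟪t, a k⟫ ^ 2 ≤ ∑ k, (1 - Real.cos (2 * Real.pi * ⟪t, a k⟫)) := by
      rw [Finset.mul_sum]
      exact Finset.sum_le_sum fun k _ => eight_mul_sq_le_one_sub_cos (hk k).le
    have h3 : ∑ k, ⟪t, a k⟫ ^ 2 = (z * σ / (2 * Real.pi)) ^ 2 * ∑ k, ⟪u, a k⟫ ^ 2 := by
      rw [Finset.mul_sum]
      exact Finset.sum_congr rfl fun k _ => by rw [ht, real_inner_smul_left, mul_pow]
    have h4 : M * σ ^ 2 / Real.pi ^ 2 * ∑ k, ⟪u, a k⟫ ^ 2 ≤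
        M / (2 * z ^ 2) * ∑ k, (1 - Real.cos (2 * Real.pi * ⟪t, a k⟫)) := by
      refine le_trans (le_of_eq ?_) (mul_le_mul_of_nonneg_left h2 (by positivity))
      rw [h3]
      field_simp
      ring
    refine le_add_of_nonneg_of_le (by positivity) ?_
    refine (mul_le_of_le_one_left (Real.exp_pos _).le
      (Real.exp_le_one_iff.2 (by nlinarith [sq_nonneg ‖u‖]))).trans (Real.exp_le_exp.2 ?_)
    linarith

/-- Bound for the Gaussian average of the characteristic function of the compound Poisson law
attached to a single jump size. -/
noncomputable def scaleBound (a : Fin n → EuclideanSpace ℝ (Fin d)) (M D α : ℝ) : ℝ :=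
  2 * ((2 * Real.pi) ^ (d / 2 : ℝ) * Real.exp (-(4 * M * α ^ 2)) +
    1 / Real.sqrt (covMat a).det *
      (Real.pi / (M * (D / (4 * Real.sqrt d)) ^ 2 / Real.pi ^ 2)) ^ (d / 2 : ℝ))

lemma average_le_scaleBound_of_le_one {a : Fin n → EuclideanSpace ℝ (Fin d)}
    (ha : (covMat a).PosDef) (hd : 0 < d) {M D α z : ℝ} (hM : 0 < M) (hD : 0 < D)
    (h : ∀ (m : Fin n → ℤ) (t : EuclideanSpace ℝ (Fin d)),
        ‖t‖ ≤ D → (∃ k, (1 / 2 : ℝ) ≤ |⟪t, a k⟫|) →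
        α ^ 2 ≤ ∑ k, (⟪t, a k⟫ - m k) ^ 2)
    (hz : 0 < z) (hz1 : z ≤ 1) :
    ∫ u : EuclideanSpace ℝ (Fin d), Real.exp (-(1 / 2) * ‖u‖ ^ 2) *
      Real.exp (-(M / (2 * z ^ 2) *
        ∑ k, (1 - Real.cos ⟪(z * (D / (4 * Real.sqrt d))) • u, a k⟫))) ≤
      scaleBound a M D α := by
  have hsd : 0 < Real.sqrt d := Real.sqrt_pos.2 (by exact_mod_cast hd)
  have hψ := GaussDecreasing.exp_sum_cos Finset.univ a (c := M / (2 * z ^ 2)) (by positivity)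
  have h1 := hψ.average_le_two_mul_setIntegral (fun t => (Real.exp_pos _).le)
    (σ := z * (D / (4 * Real.sqrt d))) (by positivity) (by simpa using hd)
  simp only [finrank_euclideanSpace, Fintype.card_fin] at h1
  refine h1.trans (mul_le_mul_of_nonneg_left ?_ (by norm_num))
  obtain ⟨hqi, hq⟩ := quadratic_gaussian a ha
    (c := M * (D / (4 * Real.sqrt d)) ^ 2 / Real.pi ^ 2) (by positivity)
  have hgi : Integrable fun u : EuclideanSpace ℝ (Fin d) =>
      Real.exp (-(1 / 2) * ‖u‖ ^ 2) * Real.exp (-(4 * M * α ^ 2)) :=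
    (integrable_gaussianWeight (by norm_num)).mul_const _
  have hg := GaussianFourier.integral_rexp_neg_mul_sq_norm (V := EuclideanSpace ℝ (Fin d))
    (b := 1 / 2) (by norm_num)
  have hpi : Real.pi / (1 / 2) = 2 * Real.pi := by ring
  rw [finrank_euclideanSpace, Fintype.card_fin, hpi] at hg
  rw [← hq, ← hg, ← integral_mul_const, ← integral_add hgi hqi]
  have hleft : Integrable fun u : EuclideanSpace ℝ (Fin d) => Real.exp (-(1 / 2) * ‖u‖ ^ 2) *
      Real.exp (-(M / (2 * z ^ 2) *
        ∑ k, (1 - Real.cos ⟪(z * (D / (4 * Real.sqrt d))) • u, a k⟫))) := by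
    simpa using GaussDecreasing.integrable hψ.continuous hψ.bounded 0 (z * (D / (4 * Real.sqrt d)))
  refine (setIntegral_mono_on hleft.integrableOn (hgi.add hqi).integrableOn
    (measurableSet_le (f := fun u : EuclideanSpace ℝ (Fin d) => ‖u‖ ^ 2) (by fun_prop)
      measurable_const) fun u hu => truncated_integrand_le hd hM hD h hz hz1 hu).trans
    (setIntegral_le_integral (hgi.add hqi) (Filter.Eventually.of_forall fun u => ?_))
  simp only [Pi.zero_apply, Pi.add_apply]
  positivity

lemma average_le_scaleBound {a : Fin n → EuclideanSpace ℝ (Fin d)}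
    (ha : (covMat a).PosDef) (hd : 0 < d) {M D α z : ℝ} (hM : 0 < M) (hD : 0 < D)
    (h : ∀ (m : Fin n → ℤ) (t : EuclideanSpace ℝ (Fin d)),
        ‖t‖ ≤ D → (∃ k, (1 / 2 : ℝ) ≤ |⟪t, a k⟫|) →
        α ^ 2 ≤ ∑ k, (⟪t, a k⟫ - m k) ^ 2)
    (hz : z ≠ 0) :
    ∫ u : EuclideanSpace ℝ (Fin d), Real.exp (-(1 / 2) * ‖u‖ ^ 2) *
      Real.exp (-(M / (2 * min (z ^ 2) 1) *
        ∑ k, (1 - Real.cos ⟪(z * (D / (4 * Real.sqrt d))) • u, a k⟫))) ≤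
      scaleBound a M D α := by
  wlog hpos : 0 < z generalizing z
  · have := this (neg_ne_zero.2 hz)
      (neg_pos.2 (lt_of_le_of_ne (not_lt.1 hpos) hz))
    simpa only [even_two.neg_pow, neg_mul, neg_smul, inner_neg_left, Real.cos_neg] using this
  rcases le_total z 1 with hz1 | hz1
  · rw [min_eq_left (by nlinarith)]
    exact average_le_scaleBound_of_le_one ha hd hM hD h hpos hz1
  · rw [min_eq_right (by nlinarith)]
    have hσ : 0 ≤ D / (4 * Real.sqrt d) := by positivity
    have hψ := GaussDecreasing.exp_sum_cos Finset.univ a (c := M / (2 * 1)) (by positivity)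
    refine (hψ.average_le' (τ := z * (D / (4 * Real.sqrt d))) hσ
      (le_mul_of_one_le_left hσ hz1)).trans ?_
    simpa only [one_mul, one_pow] using
      average_le_scaleBound_of_le_one ha hd hM hD h one_pos le_rfl

end ScaleBound

section CharacteristicFunction

lemma mul_exp_neg_integral_le {Ω : Type*} [MeasurableSpace Ω] {P : Measure Ω}
    [IsProbabilityMeasure P] {w f : Ω → ℝ} {C : ℝ} (hwm : Measurable w) (hfm : Measurable f)
    (hw : ∀ p, 0 ≤ w p) (hw1 : ∀ p, w p ≤ 1) (hf : ∀ p, 0 ≤ f p) (hfC : ∀ p, f p ≤ C)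
    (hwf : ∀ p, w p = 0 → f p = 0) :
    (∫ p, w p ∂P) * Real.exp (-∫ p, f p ∂P) ≤
      ∫ p, w p * Real.exp (-((∫ p, w p ∂P) / w p * f p)) ∂P := by
  set M := ∫ p, w p ∂P
  set m := ∫ p, f p ∂P
  have hM : 0 ≤ M := integral_nonneg hw
  have hwi : Integrable w P := Integrable.of_bound hwm.aestronglyMeasurable 1
    (Filter.Eventually.of_forall fun p => by
      rw [Real.norm_eq_abs, abs_of_nonneg (hw p)]; exact hw1 p)
  have hfi : Integrable f P := Integrable.of_bound hfm.aestronglyMeasurable C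
    (Filter.Eventually.of_forall fun p => by
      rw [Real.norm_eq_abs, abs_of_nonneg (hf p)]; exact hfC p)
  have hri : Integrable (fun p => w p * Real.exp (-(M / w p * f p))) P := by
    refine hwi.mul_bdd (c := 1) (by fun_prop) (Filter.Eventually.of_forall fun p => ?_)
    rw [Real.norm_eq_abs, Real.abs_exp, Real.exp_le_one_iff, neg_nonpos]
    exact mul_nonneg (div_nonneg hM (hw p)) (hf p)
  have hli : Integrable (fun p => Real.exp (-m) * ((1 + m) * w p - M * f p)) P :=
    ((hwi.const_mul _).sub (hfi.const_mul _)).const_mul _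
  have hval : ∫ p, Real.exp (-m) * ((1 + m) * w p - M * f p) ∂P = M * Real.exp (-m) := by
    rw [integral_const_mul, integral_sub (hwi.const_mul _) (hfi.const_mul _),
      integral_const_mul, integral_const_mul]
    ring
  rw [← hval]
  refine integral_mono hli hri fun p => ?_
  have h1 := Real.add_one_le_exp (m - M / w p * f p)
  have h2 : w p * (M / w p * f p) = M * f p := by
    rcases eq_or_ne (w p) 0 with h0 | h0
    · simp [h0, hwf p h0]
    · field_simp
  calc Real.exp (-m) * ((1 + m) * w p - M * f p)
      = w p * (Real.exp (-m) * (m - M / w p * f p + 1)) := by rw [← h2]; ring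
    _ ≤ w p * (Real.exp (-m) * Real.exp (m - M / w p * f p)) := by
        have := hw p
        gcongr
    _ = w p * Real.exp (-(M / w p * f p)) := by
        rw [← Real.exp_add]; congr 2; ring

lemma norm_charFun_le (ν : Measure ℝ) [IsProbabilityMeasure ν] (s : ℝ) :
    ‖∫ x, Complex.exp (s * x * Complex.I) ∂ν‖ ≤
      Real.exp (-(1 / 2 * ∫ p : ℝ × ℝ, (1 - Real.cos (s * (p.1 - p.2))) ∂(ν.prod ν))) := by
  set φ := ∫ x, Complex.exp (s * x * Complex.I) ∂ν
  have hconj : starRingEnd ℂ φ = ∫ x, Complex.exp (-(s * x * Complex.I)) ∂ν := by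
    rw [← integral_conj]
    refine integral_congr_ae (Filter.Eventually.of_forall fun x => ?_)
    simp [← Complex.exp_conj]
  have hint : Integrable (fun p : ℝ × ℝ => Complex.exp ((s * (p.1 - p.2) : ℝ) * Complex.I))
      (ν.prod ν) :=
    Integrable.of_bound (by fun_prop) 1
      (Filter.Eventually.of_forall fun p => (Complex.norm_exp_ofReal_mul_I _).le)
  have hsq : ‖φ‖ ^ 2 = ∫ p : ℝ × ℝ, Real.cos (s * (p.1 - p.2)) ∂(ν.prod ν) := by
    have h1 : ((‖φ‖ ^ 2 : ℝ) : ℂ) =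
        ∫ p : ℝ × ℝ, Complex.exp ((s * (p.1 - p.2) : ℝ) * Complex.I) ∂(ν.prod ν) := by
      push_cast
      rw [← Complex.mul_conj', hconj, ← integral_prod_mul]
      refine integral_congr_ae (Filter.Eventually.of_forall fun p => ?_)
      simp only [← Complex.exp_add]
      ring_nf
    have h2 := congrArg Complex.re h1
    have h3 := integral_re (𝕜 := ℂ) hint
    simp only [RCLike.re_eq_complex_re, Complex.exp_ofReal_mul_I_re] at h3
    rw [← h3, Complex.ofReal_re] at h2
    exact h2
  have hcos : Integrable (fun p : ℝ × ℝ => Real.cos (s * (p.1 - p.2))) (ν.prod ν) :=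
    Integrable.of_bound (by fun_prop) 1
      (Filter.Eventually.of_forall fun p => Real.abs_cos_le_one _)
  rw [integral_sub (integrable_const _) hcos, ← hsq]
  simp only [integral_const, probReal_univ, smul_eq_mul, mul_one]
  refine abs_le_of_sq_le_sq' ?_ (Real.exp_pos _).le |>.2
  rw [← Real.exp_nat_mul]
  have := Real.add_one_le_exp (‖φ‖ ^ 2 - 1)
  refine le_trans (by linarith) (this.trans (Real.exp_le_exp.2 (le_of_eq ?_)))
  push_cast
  ring

lemma norm_charFun_sum_le {d n : ℕ} (ν : Measure ℝ) [IsProbabilityMeasure ν]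
    (a : Fin n → EuclideanSpace ℝ (Fin d)) (t : EuclideanSpace ℝ (Fin d)) :
    ‖∫ ω : Fin n → ℝ, Complex.exp (⟪t, ∑ k, ω k • a k⟫ * Complex.I)
        ∂(Measure.pi fun _ => ν)‖ ≤
      Real.exp (-∫ p : ℝ × ℝ, 1 / 2 * ∑ k, (1 - Real.cos ⟪(p.1 - p.2) • t, a k⟫)
        ∂(ν.prod ν)) := by
  have h1 (ω : Fin n → ℝ) : Complex.exp (⟪t, ∑ k, ω k • a k⟫ * Complex.I) =
      ∏ k, Complex.exp ((⟪t, a k⟫ : ℝ) * ω k * Complex.I) := by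
    rw [← Complex.exp_sum, inner_sum]
    congr 1
    push_cast [real_inner_smul_right]
    rw [Finset.sum_mul]
    exact Finset.sum_congr rfl fun k _ => by ring
  simp only [h1]
  rw [integral_fintype_prod_eq_prod (𝕜 := ℂ)
    (fun k (x : ℝ) => Complex.exp ((⟪t, a k⟫ : ℝ) * x * Complex.I)), norm_prod]
  refine (Finset.prod_le_prod (fun _ _ => norm_nonneg _)
    fun k _ => norm_charFun_le ν ⟪t, a k⟫).trans (le_of_eq ?_)
  rw [← Real.exp_sum, integral_const_mul, integral_finsetSum]
  · rw [Finset.sum_neg_distrib, Finset.mul_sum]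
    simp only [real_inner_smul_left, mul_comm]
  · exact fun k _ => (integrable_const _).sub (Integrable.of_bound (by fun_prop) 1
      (Filter.Eventually.of_forall fun p => Real.abs_cos_le_one _))

end CharacteristicFunction

section Smoothing

variable {d n : ℕ}

lemma gaussian_smoothing_le (ν : Measure ℝ) [IsProbabilityMeasure ν]
    (a : Fin n → EuclideanSpace ℝ (Fin d)) (x : EuclideanSpace ℝ (Fin d)) (σ : ℝ) :
    (2 * Real.pi) ^ (d / 2 : ℝ) *
        ∫ ω : Fin n → ℝ, Real.exp (-(‖σ • (∑ k, ω k • a k - x)‖ ^ 2 / 2))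
          ∂(Measure.pi fun _ => ν) ≤
      ∫ u : EuclideanSpace ℝ (Fin d), Real.exp (-(1 / 2) * ‖u‖ ^ 2) *
        Real.exp (-∫ p : ℝ × ℝ, 1 / 2 * ∑ k, (1 - Real.cos ⟪(p.1 - p.2) • σ • u, a k⟫)
          ∂(ν.prod ν)) := by
  set P : Measure (Fin n → ℝ) := Measure.pi fun _ => ν
  have hgauss := integrable_gaussianWeight (V := EuclideanSpace ℝ (Fin d)) (b := 1 / 2)
    (by norm_num)
  have hjoint : Integrable (Function.uncurry fun (ω : Fin n → ℝ) (u : EuclideanSpace ℝ (Fin d)) =>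
      Real.exp (-(1 / 2) * ‖u‖ ^ 2) * Real.cos ⟪u, σ • (∑ k, ω k • a k - x)⟫)
      (P.prod volume) := by
    have h1 : Integrable (fun q : (Fin n → ℝ) × EuclideanSpace ℝ (Fin d) =>
        (1 : ℝ) * Real.exp (-(1 / 2) * ‖q.2‖ ^ 2)) (P.prod volume) :=
      (integrable_const (1 : ℝ)).mul_prod hgauss
    simp only [one_mul] at h1
    refine h1.mul_bdd (c := 1) ?_ (Filter.Eventually.of_forall fun p => Real.abs_cos_le_one _)
    have : Continuous fun q : (Fin n → ℝ) × EuclideanSpace ℝ (Fin d) =>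
        Real.cos ⟪q.2, σ • (∑ k, q.1 k • a k - x)⟫ := by fun_prop
    exact this.aestronglyMeasurable
  have hstep : (2 * Real.pi) ^ (d / 2 : ℝ) *
      ∫ ω : Fin n → ℝ, Real.exp (-(‖σ • (∑ k, ω k • a k - x)‖ ^ 2 / 2)) ∂P =
      ∫ u : EuclideanSpace ℝ (Fin d), Real.exp (-(1 / 2) * ‖u‖ ^ 2) *
        ∫ ω : Fin n → ℝ, Real.cos ⟪u, σ • (∑ k, ω k • a k - x)⟫ ∂P := by
    rw [← integral_const_mul]
    simp only [← integral_const_mul]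
    rw [← integral_integral_swap hjoint]
    refine integral_congr_ae (Filter.Eventually.of_forall fun ω => ?_)
    simp only [integral_gaussianWeight_mul_cos, finrank_euclideanSpace, Fintype.card_fin]
  rw [hstep]
  have hleft : Integrable (fun u : EuclideanSpace ℝ (Fin d) => Real.exp (-(1 / 2) * ‖u‖ ^ 2) *
        ∫ ω : Fin n → ℝ, Real.cos ⟪u, σ • (∑ k, ω k • a k - x)⟫ ∂P) := by
    have := hjoint.integral_prod_right
    simpa only [Function.uncurry_apply_pair, integral_const_mul] using this
  have hright : Integrable (fun u : EuclideanSpace ℝ (Fin d) => Real.exp (-(1 / 2) * ‖u‖ ^ 2) *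
        Real.exp (-∫ p : ℝ × ℝ, 1 / 2 * ∑ k, (1 - Real.cos ⟪(p.1 - p.2) • σ • u, a k⟫)
          ∂(ν.prod ν))) := by
    refine integrable_gaussianWeight_mul (C := 1) (by norm_num) ?_ fun u => ?_
    · have hc : Continuous (Function.uncurry fun (u : EuclideanSpace ℝ (Fin d)) (p : ℝ × ℝ) =>
          1 / 2 * ∑ k, (1 - Real.cos ⟪(p.1 - p.2) • σ • u, a k⟫)) := by
        unfold Function.uncurry
        fun_prop
      have hm := (hc.stronglyMeasurable.integral_prod_right (ν := ν.prod ν)).measurable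
      exact (Real.measurable_exp.comp hm.neg).aestronglyMeasurable
    · rw [Real.abs_exp, Real.exp_le_one_iff, neg_nonpos]
      exact integral_nonneg fun p => mul_nonneg (by norm_num)
        (Finset.sum_nonneg fun k _ => sub_nonneg.2 (Real.cos_le_one _))
  refine integral_mono hleft hright fun u => ?_
  refine mul_le_mul_of_nonneg_left ?_ (Real.exp_pos _).le
  refine le_trans ?_ (norm_charFun_sum_le ν a (σ • u))
  have hexp (ω : Fin n → ℝ) :
      Complex.exp ((⟪u, σ • (∑ k, ω k • a k - x)⟫ : ℝ) * Complex.I) =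
      Complex.exp ((-⟪σ • u, x⟫ : ℝ) * Complex.I) *
        Complex.exp (⟪σ • u, ∑ k, ω k • a k⟫ * Complex.I) := by
    rw [← Complex.exp_add, real_inner_smul_right, inner_sub_right, real_inner_smul_left,
      real_inner_smul_left]
    congr 1
    push_cast
    ring
  have hcos : ∫ ω : Fin n → ℝ, Real.cos ⟪u, σ • (∑ k, ω k • a k - x)⟫ ∂P =
      (∫ ω : Fin n → ℝ, Complex.exp ((⟪u, σ • (∑ k, ω k • a k - x)⟫ : ℝ) * Complex.I) ∂P).re := by
    have hi : Integrable (fun ω : Fin n → ℝ =>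
        Complex.exp ((⟪u, σ • (∑ k, ω k • a k - x)⟫ : ℝ) * Complex.I)) P :=
      Integrable.of_bound (Continuous.aestronglyMeasurable (by fun_prop)) 1
        (Filter.Eventually.of_forall fun p => (Complex.norm_exp_ofReal_mul_I _).le)
    have h3 := integral_re (𝕜 := ℂ) hi
    simp only [RCLike.re_eq_complex_re, Complex.exp_ofReal_mul_I_re] at h3
    exact h3
  rw [hcos]
  refine (Complex.re_le_norm _).trans (le_of_eq ?_)
  simp only [hexp]
  rw [integral_const_mul, norm_mul, Complex.norm_exp_ofReal_mul_I, one_mul]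

lemma Mfn_one (ν : Measure ℝ) :
    Mfn ν 1 = ∫ p : ℝ × ℝ, min ((p.1 - p.2) ^ 2) 1 ∂(ν.prod ν) := by
  simp [Mfn]

lemma average_exp_le_scaleBound {a : Fin n → EuclideanSpace ℝ (Fin d)}
    (ha : (covMat a).PosDef) (hd : 0 < d) (ν : Measure ℝ) [IsProbabilityMeasure ν]
    (hM : 0 < Mfn ν 1) {D α : ℝ} (hD : 0 < D)
    (h : ∀ (m : Fin n → ℤ) (t : EuclideanSpace ℝ (Fin d)),
        ‖t‖ ≤ D → (∃ k, (1 / 2 : ℝ) ≤ |⟪t, a k⟫|) →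
        α ^ 2 ≤ ∑ k, (⟪t, a k⟫ - m k) ^ 2) :
    ∫ u : EuclideanSpace ℝ (Fin d), Real.exp (-(1 / 2) * ‖u‖ ^ 2) *
        Real.exp (-∫ p : ℝ × ℝ, 1 / 2 * ∑ k,
          (1 - Real.cos ⟪(p.1 - p.2) • (D / (4 * Real.sqrt d)) • u, a k⟫) ∂(ν.prod ν)) ≤
      scaleBound a (Mfn ν 1) D α := by
  set σ := D / (4 * Real.sqrt d)
  set M := Mfn ν 1
  set P := ν.prod ν
  set w : ℝ × ℝ → ℝ := fun p => min ((p.1 - p.2) ^ 2) 1 with hw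
  have hwM : ∫ p, w p ∂P = M := (Mfn_one ν).symm
  have hwm : Measurable w := by fun_prop
  have hw0 (p : ℝ × ℝ) : 0 ≤ w p := le_min (sq_nonneg _) zero_le_one
  have hwi : Integrable w P := Integrable.of_bound hwm.aestronglyMeasurable 1
    (Filter.Eventually.of_forall fun p => by
      rw [Real.norm_eq_abs, abs_of_nonneg (hw0 p)]; exact min_le_right _ _)
  set f : EuclideanSpace ℝ (Fin d) → ℝ × ℝ → ℝ := fun u p =>
    1 / 2 * ∑ k, (1 - Real.cos ⟪(p.1 - p.2) • σ • u, a k⟫) with hf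
  have hf0 (u p) : 0 ≤ f u p := mul_nonneg (by norm_num)
    (Finset.sum_nonneg fun k _ => sub_nonneg.2 (Real.cos_le_one _))
  have hfc : Continuous (fun q : (ℝ × ℝ) × EuclideanSpace ℝ (Fin d) => f q.2 q.1) := by
    simp only [hf]
    fun_prop
  have hjensen (u : EuclideanSpace ℝ (Fin d)) :
      M * Real.exp (-∫ p, f u p ∂P) ≤ ∫ p, w p * Real.exp (-(M / w p * f u p)) ∂P := by
    have := mul_exp_neg_integral_le (P := P) (w := w) (f := f u) (C := n) hwm
      (by simp only [hf]; fun_prop) hw0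
      (fun p => min_le_right _ _) (hf0 u) (fun p => ?_) (fun p hp => ?_)
    · rwa [hwM] at this
    · have : ∑ k, (1 - Real.cos ⟪(p.1 - p.2) • σ • u, a k⟫) ≤ ∑ _k : Fin n, (2 : ℝ) :=
        Finset.sum_le_sum fun k _ => by linarith [Real.neg_one_le_cos ⟪(p.1 - p.2) • σ • u, a k⟫]
      simp only [Finset.sum_const, Finset.card_univ, Fintype.card_fin, nsmul_eq_mul] at this
      simp only [hf]
      linarith
    · have hp' : p.1 - p.2 = 0 := by
        by_contra hne
        have : 0 < w p := lt_min (by positivity) one_pos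
        exact this.ne' hp
      simp [hf, hp']
  have hjoint : Integrable (Function.uncurry fun (p : ℝ × ℝ) (u : EuclideanSpace ℝ (Fin d)) =>
      w p * (Real.exp (-(1 / 2) * ‖u‖ ^ 2) * Real.exp (-(M / w p * f u p)))) (P.prod volume) := by
    have h1 := hwi.mul_prod (ν := (volume : Measure (EuclideanSpace ℝ (Fin d))))
      (integrable_gaussianWeight (V := EuclideanSpace ℝ (Fin d)) (b := 1 / 2) (by norm_num))
    have hmeas : Measurable fun q : (ℝ × ℝ) × EuclideanSpace ℝ (Fin d) =>
        Real.exp (-(M / w q.1 * f q.2 q.1)) :=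
      Real.measurable_exp.comp
        ((measurable_const.div (hwm.comp measurable_fst)).mul hfc.measurable).neg
    have h2 := h1.mul_bdd (c := 1) hmeas.aestronglyMeasurable
      (Filter.Eventually.of_forall fun q => by
        rw [Real.norm_eq_abs, Real.abs_exp, Real.exp_le_one_iff, neg_nonpos]
        exact mul_nonneg (div_nonneg hM.le (hw0 _)) (hf0 _ _))
    refine h2.congr (Filter.Eventually.of_forall fun q => ?_)
    simp only [Function.uncurry]
    ring
  have hinner (p : ℝ × ℝ) :
      ∫ u : EuclideanSpace ℝ (Fin d),
        w p * (Real.exp (-(1 / 2) * ‖u‖ ^ 2) * Real.exp (-(M / w p * f u p))) ≤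
      w p * scaleBound a M D α := by
    rw [integral_const_mul]
    rcases eq_or_ne (p.1 - p.2) 0 with hp | hp
    · simp [hw, hp]
    · refine mul_le_mul_of_nonneg_left ?_ (hw0 p)
      refine le_trans (le_of_eq (integral_congr_ae (Filter.Eventually.of_forall fun u => ?_)))
        (average_le_scaleBound ha hd hM hD h hp)
      have e (S : ℝ) : M / w p * (1 / 2 * S) = M / (2 * min ((p.1 - p.2) ^ 2) 1) * S := by
        simp only [hw, div_eq_mul_inv, mul_inv]
        ring
      simp only [hf, smul_smul, e]
      rfl
  have hleft : Integrable (fun u : EuclideanSpace ℝ (Fin d) =>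
      ∫ p, w p * (Real.exp (-(1 / 2) * ‖u‖ ^ 2) * Real.exp (-(M / w p * f u p))) ∂P) :=
    hjoint.integral_prod_right
  have hchain : M * ∫ u : EuclideanSpace ℝ (Fin d), Real.exp (-(1 / 2) * ‖u‖ ^ 2) *
      Real.exp (-∫ p, f u p ∂P) ≤ M * scaleBound a M D α := by
    rw [← integral_const_mul]
    calc ∫ u : EuclideanSpace ℝ (Fin d), M * (Real.exp (-(1 / 2) * ‖u‖ ^ 2) *
          Real.exp (-∫ p, f u p ∂P))
        ≤ ∫ u : EuclideanSpace ℝ (Fin d),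
          ∫ p, w p * (Real.exp (-(1 / 2) * ‖u‖ ^ 2) * Real.exp (-(M / w p * f u p))) ∂P := by
          refine integral_mono_of_nonneg (Filter.Eventually.of_forall fun u => by positivity) hleft
            (Filter.Eventually.of_forall fun u => ?_)
          have e : ∫ p, w p * (Real.exp (-(1 / 2) * ‖u‖ ^ 2) * Real.exp (-(M / w p * f u p))) ∂P =
              Real.exp (-(1 / 2) * ‖u‖ ^ 2) * ∫ p, w p * Real.exp (-(M / w p * f u p)) ∂P := by
            rw [← integral_const_mul]
            exact integral_congr_ae (Filter.Eventually.of_forall fun p => by ring)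
          simp only [e]
          rw [mul_left_comm]
          exact mul_le_mul_of_nonneg_left (hjensen u) (Real.exp_pos _).le
      _ = ∫ p, (∫ u : EuclideanSpace ℝ (Fin d),
          w p * (Real.exp (-(1 / 2) * ‖u‖ ^ 2) * Real.exp (-(M / w p * f u p)))) ∂P :=
          (integral_integral_swap hjoint).symm
      _ ≤ ∫ p, w p * scaleBound a M D α ∂P :=
          integral_mono hjoint.integral_prod_left (hwi.mul_const _) hinner
      _ = M * scaleBound a M D α := by rw [integral_mul_const, hwM]
  exact le_of_mul_le_mul_left hchain hM

lemma sumLaw_closedBall_le (ν : Measure ℝ) [IsProbabilityMeasure ν]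
    (a : Fin n → EuclideanSpace ℝ (Fin d)) (x : EuclideanSpace ℝ (Fin d)) (σ r : ℝ) :
    (sumLaw ν a (Metric.closedBall x r)).toReal ≤ Real.exp ((σ * r) ^ 2 / 2) *
      ∫ ω : Fin n → ℝ, Real.exp (-(‖σ • (∑ k, ω k • a k - x)‖ ^ 2 / 2))
          ∂(Measure.pi fun _ => ν) := by
  set P : Measure (Fin n → ℝ) := Measure.pi fun _ => ν
  have hS : Continuous fun ω : Fin n → ℝ => ∑ k, ω k • a k := by fun_prop
  set s : Set (Fin n → ℝ) := (fun ω => ∑ k, ω k • a k) ⁻¹' Metric.closedBall x r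
  have hs : MeasurableSet s := hS.measurable Metric.isClosed_closedBall.measurableSet
  rw [sumLaw, Measure.map_apply hS.measurable Metric.isClosed_closedBall.measurableSet]
  change P.real s ≤ _
  rw [← integral_indicator_one hs, ← integral_const_mul]
  have hi : Integrable (fun ω : Fin n → ℝ => Real.exp ((σ * r) ^ 2 / 2) *
      Real.exp (-(‖σ • (∑ k, ω k • a k - x)‖ ^ 2 / 2))) P := by
    refine Integrable.const_mul (Integrable.of_bound
      (Continuous.aestronglyMeasurable (by fun_prop)) 1 (Filter.Eventually.of_forall fun ω => ?_)) _
    rw [Real.norm_eq_abs, Real.abs_exp, Real.exp_le_one_iff]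
    have := sq_nonneg ‖σ • (∑ k, ω k • a k - x)‖
    linarith
  refine integral_mono ((integrable_const (1 : ℝ)).indicator hs) hi fun ω => ?_
  by_cases hω : ω ∈ s
  · rw [Set.indicator_of_mem hω, Pi.one_apply, ← Real.exp_add, Real.one_le_exp_iff]
    have h1 : ‖∑ k, ω k • a k - x‖ ≤ r := mem_closedBall_iff_norm.1 hω
    have h2 : ‖σ • (∑ k, ω k • a k - x)‖ ^ 2 ≤ (σ * r) ^ 2 := by
      rw [norm_smul, mul_pow, mul_pow, Real.norm_eq_abs, sq_abs]
      gcongr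
    linarith
  · rw [Set.indicator_of_notMem hω]
    positivity

lemma rpow_natCast_div_two {x : ℝ} (hx : 0 ≤ x) (d : ℕ) :
    x ^ (d / 2 : ℝ) = Real.sqrt x ^ d := by
  rw [Real.sqrt_eq_rpow, ← Real.rpow_mul_natCast hx]
  congr 1
  ring

lemma exp_mul_scaleBound_le (a : Fin n → EuclideanSpace ℝ (Fin d)) (hd : 0 < d)
    {M D : ℝ} (hM : 0 < M) (hD : 0 < D) (α : ℝ) :
    Real.exp (d / 32) * scaleBound a M D α ≤
      (2 * Real.pi) ^ (d / 2 : ℝ) * (36 ^ d * ((Real.sqrt d / (D * Real.sqrt M)) ^ d *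
        (1 / Real.sqrt (covMat a).det) + Real.exp (-4 * α ^ 2 * M))) := by
  have hsd : 0 < Real.sqrt d := Real.sqrt_pos.2 (by exact_mod_cast hd)
  have hsM : 0 < Real.sqrt M := Real.sqrt_pos.2 hM
  set R := Real.sqrt d / (D * Real.sqrt M) with hR
  have hR0 : 0 ≤ R := by positivity
  have hroot : Real.sqrt (Real.pi / (M * (D / (4 * Real.sqrt d)) ^ 2 / Real.pi ^ 2)) ≤
      9 * R * Real.sqrt (2 * Real.pi) := by
    refine Real.sqrt_le_iff.2 ⟨by positivity, ?_⟩
    rw [mul_pow, Real.sq_sqrt (by positivity)]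
    have e1 : Real.pi / (M * (D / (4 * Real.sqrt d)) ^ 2 / Real.pi ^ 2) =
        R ^ 2 * Real.pi * (16 * Real.pi ^ 2) := by
      have hMM : M = Real.sqrt M ^ 2 := (Real.sq_sqrt hM.le).symm
      rw [hR]
      conv_lhs => rw [hMM]
      field_simp
      ring
    have e2 : 16 * Real.pi ^ 2 ≤ 162 := by
      nlinarith [Real.pi_lt_d2, Real.pi_pos]
    rw [e1]
    have := mul_le_mul_of_nonneg_left e2 (show 0 ≤ R ^ 2 * Real.pi by positivity)
    linarith
  have hexp : Real.exp (d / 32) ≤ 2 ^ d := by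
    have h1 : Real.exp (d / 32) = Real.exp (1 / 32) ^ d := by
      rw [← Real.exp_nat_mul]; congr 1; ring
    rw [h1]
    gcongr
    have h2 : Real.exp (1 / 32) ≤ Real.exp (Real.log 2) :=
      Real.exp_le_exp.2 (by linarith [Real.log_two_gt_d9])
    rwa [Real.exp_log (by norm_num)] at h2
  have htwo : (2 : ℝ) ≤ 2 ^ d := le_self_pow₀ (by norm_num) hd.ne'
  rw [scaleBound, rpow_natCast_div_two (by positivity), rpow_natCast_div_two (by positivity)]
  have e4 : -4 * α ^ 2 * M = -(4 * M * α ^ 2) := by ring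
  rw [e4]
  set Ee := Real.exp (-(4 * M * α ^ 2))
  set T := 1 / Real.sqrt (covMat a).det
  have hT : 0 ≤ T := by positivity
  set L := Real.sqrt (2 * Real.pi)
  calc Real.exp (d / 32) * (2 * (L ^ d * Ee + T *
        Real.sqrt (Real.pi / (M * (D / (4 * Real.sqrt d)) ^ 2 / Real.pi ^ 2)) ^ d))
      ≤ 2 ^ d * (2 ^ d * (L ^ d * (9 ^ d * Ee) + T * (9 * R * L) ^ d)) := by
        gcongr
        exact le_mul_of_one_le_left (Real.exp_pos _).le (one_le_pow₀ (by norm_num))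
    _ = L ^ d * (36 ^ d * (R ^ d * T + Ee)) := by
        have : (36 : ℝ) ^ d = 2 ^ d * 2 ^ d * 9 ^ d := by
          rw [← mul_pow, ← mul_pow]; norm_num
        rw [this, mul_pow, mul_pow]
        ring

end Smoothing

theorem stmt_1 :
    ∃ c₁ c₂ : ℝ, 0 < c₁ ∧ 0 < c₂ ∧
      ∀ (d n : ℕ), 0 < d →
      ∀ (ν : Measure ℝ), IsProbabilityMeasure ν →
      ∀ (a : Fin n → EuclideanSpace ℝ (Fin d)),
      (covMat a).PosDef →
      0 < Mfn ν 1 →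
      ∀ D α : ℝ, 0 < D → 0 < α →
      (∀ (m : Fin n → ℤ) (t : EuclideanSpace ℝ (Fin d)),
        ‖t‖ ≤ D → (∃ k, (1 / 2 : ℝ) ≤ |⟪t, a k⟫|) →
        α ^ 2 ≤ ∑ k, (⟪t, a k⟫ - m k) ^ 2) →
      concFn (sumLaw ν a) (d / D) ≤
        c₁ ^ d * ((Real.sqrt d / (D * Real.sqrt (Mfn ν 1))) ^ d
            * (1 / Real.sqrt (covMat a).det)
          + Real.exp (-c₂ * α ^ 2 * Mfn ν 1)) := by
  refine ⟨36, 4, by norm_num, by norm_num, ?_⟩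
  intro d n hd ν _ a ha hM D α hD _ h
  refine ciSup_le fun x => ?_
  have hsd : 0 < Real.sqrt d := Real.sqrt_pos.2 (by exact_mod_cast hd)
  have hpi : 0 < (2 * Real.pi) ^ (d / 2 : ℝ) := by positivity
  have hball := sumLaw_closedBall_le ν a x (D / (4 * Real.sqrt d)) (d / D)
  have hscale : (D / (4 * Real.sqrt d) * (d / D)) ^ 2 / 2 = (d / 32 : ℝ) := by
    have hdd : (d : ℝ) = Real.sqrt d ^ 2 := (Real.sq_sqrt (Nat.cast_nonneg d)).symm
    have : D / (4 * Real.sqrt d) * (d / D) = Real.sqrt d / 4 := by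
      nth_rewrite 2 [hdd]
      field_simp
    rw [this, div_pow, ← hdd]
    ring
  rw [hscale] at hball
  refine le_of_mul_le_mul_left ?_ hpi
  refine le_trans ?_ (exp_mul_scaleBound_le a hd hM hD α)
  refine (mul_le_mul_of_nonneg_left hball hpi.le).trans ?_
  rw [mul_left_comm]
  refine mul_le_mul_of_nonneg_left ?_ (Real.exp_pos _).le
  exact (gaussian_smoothing_le ν a x (D / (4 * Real.sqrt d))).trans
    (average_exp_le_scaleBound ha hd ν hM hD h)
end
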